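/- If S is a set of positive integers almost closed under addition, then there exists a fully divergent, infinite in limit basic sequence Q such that dim_H( DN(Q) ∩ DN_{Ab}(Q) ∩ RN^{I}(Q) ∩ RN^{II}(Q) ∩ N^{I}_{Ab}(Q) ∩ ⋂_{k∈S} N_k(Q) \ (N^{II}(Q) ∪ ⋃_{k∉S} N_k(Q)) ) = 1. -/

import Mathlib

open Filter MeasureTheory Finset
open scoped Topology Classical

/-- A basic sequence: a sequence of integers, each at least `2`. -/
def IsBasic (q : ℕ → ℕ) : Prop := ∀ n, 2 ≤ q n

/-- The product `q_0 q_1 ⋯ q_{n-1}` of the first `n` terms of the basic sequence. -/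
def qprod (q : ℕ → ℕ) (n : ℕ) : ℝ := ∏ i ∈ Finset.range n, (q i : ℝ)

/-- `T_{Q,n}(x) = (q_0 q_1 ⋯ q_{n-1}) x mod 1`. -/
noncomputable def TQ (q : ℕ → ℕ) (n : ℕ) (x : ℝ) : ℝ := Int.fract (qprod q n * x)

/-- The `n`-th digit `E_n` of the `Q`-Cantor series expansion of `x`
(digit positions are indexed by `0, 1, 2, …`). -/
noncomputable def qdigit (q : ℕ → ℕ) (x : ℝ) (n : ℕ) : ℕ := ⌊(q n : ℝ) * TQ q n x⌋₊

/-- `N_n^Q(B,x)`: the number of occurrences of the block `B` starting among the first `n`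
digit positions of the `Q`-Cantor series expansion of `x`. -/
noncomputable def blockCount (q : ℕ → ℕ) (x : ℝ) {k : ℕ} (B : Fin k → ℕ) (n : ℕ) : ℕ :=
  ((Finset.range n).filter fun i => ∀ j : Fin k, qdigit q x (i + (j : ℕ)) = B j).card

/-- `Q_n^{(k)} = ∑_{j<n} 1/(q_j q_{j+1} ⋯ q_{j+k-1})`. -/
noncomputable def Qsum (q : ℕ → ℕ) (k n : ℕ) : ℝ :=
  ∑ j ∈ Finset.range n, (∏ i ∈ Finset.range k, (q (j + i) : ℝ))⁻¹

/-- `x` is `Q`-normal of order `k`: every block of length `k` occurs with the expected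
asymptotic frequency. -/
def QNormalOfOrder (q : ℕ → ℕ) (k : ℕ) (x : ℝ) : Prop :=
  ∀ B : Fin k → ℕ,
    Tendsto (fun n => (blockCount q x B n : ℝ) / Qsum q k n) atTop (𝓝 1)

/-- `x ∈ N(Q)`: `x` is `Q`-normal of every order `k ≥ 1`. -/
def QNormal (q : ℕ → ℕ) (x : ℝ) : Prop := ∀ k, 1 ≤ k → QNormalOfOrder q k x

/-- `Q` is fully divergent: `Q_n^{(k)} → ∞` for every `k ≥ 1`. -/
def FullyDivergent (q : ℕ → ℕ) : Prop :=
  ∀ k, 1 ≤ k → Tendsto (fun n => Qsum q k n) atTop atTop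

/-- `Q` is infinite in limit: `q_n → ∞`. -/
def InfiniteInLimit (q : ℕ → ℕ) : Prop := Tendsto q atTop atTop

/-- `N_{n,m,r}^Q(B,x)`: occurrences of the block `B` (of length `m`) starting at
positions `i < n` with `i ≡ r (mod m)`. -/
noncomputable def apCount (q : ℕ → ℕ) (x : ℝ) (m r : ℕ) (B : Fin m → ℕ) (n : ℕ) : ℕ :=
  ((Finset.range n).filter fun i =>
    i % m = r ∧ ∀ j : Fin m, qdigit q x (i + (j : ℕ)) = B j).card

/-- `Q_n^{(m,r)} = ∑_{j=0}^{⌊(n-r)/m⌋} 1/(q_{mj+r} q_{mj+r+1} ⋯ q_{mj+r+m-1})`. -/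
noncomputable def apQsum (q : ℕ → ℕ) (m r n : ℕ) : ℝ :=
  ∑ j ∈ Finset.range ((n - r) / m + 1),
    (∏ i ∈ Finset.range m, (q (m * j + r + i) : ℝ))⁻¹

/-- `x ∈ N^{I}_{m,r}(Q)`. -/
def MemNAPI (q : ℕ → ℕ) (m r : ℕ) (x : ℝ) : Prop :=
  ∀ B : Fin m → ℕ,
    Tendsto (fun n => (apCount q x m r B n : ℝ) / apQsum q m r n) atTop (𝓝 1)

/-- `x ∈ N^{I}_{Ab}(Q)`: `x` is AP `Q`-abnormal of type I. -/
def APAbnormalI (q : ℕ → ℕ) (x : ℝ) : Prop :=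
  ∀ m, 2 ≤ m → ∀ r, r < m → ¬ MemNAPI q m r x

/-- `x ∈ RN^{I}(Q)`. -/
def MemRNI (q : ℕ → ℕ) (x : ℝ) : Prop :=
  ∀ m, 1 ≤ m → ∀ r, r < m → ∀ B₁ B₂ : Fin m → ℕ,
    Tendsto (fun n => (apCount q x m r B₁ n : ℝ) / (apCount q x m r B₂ n : ℝ))
      atTop (𝓝 1)

/-- `Λ_{m,r}(Q) = (q_{mt+r})_t`. -/
def lamQ (q : ℕ → ℕ) (m r : ℕ) : ℕ → ℕ := fun t => q (m * t + r)

/-- `Υ_{Q,m,r}(x)`: the real number whose `Λ_{m,r}(Q)`-Cantor series digits are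
`(E_{mt+r})_t`, where `(E_n)` are the `Q`-Cantor series digits of `x`. -/
noncomputable def Ups (q : ℕ → ℕ) (m r : ℕ) (x : ℝ) : ℝ :=
  ∑' t : ℕ, (qdigit q x (m * t + r) : ℝ) / ∏ i ∈ Finset.range (t + 1), (lamQ q m r i : ℝ)

/-- `x ∈ N^{II}_{k,m,r}(Q) = Υ_{Q,m,r}^{-1}(N_k(Λ_{m,r}(Q)))`. -/
def MemNAPII (q : ℕ → ℕ) (k m r : ℕ) (x : ℝ) : Prop :=
  QNormalOfOrder (lamQ q m r) k (Ups q m r x)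

/-- `x ∈ N^{II}(Q)`: `x` is AP `Q`-normal of type II. -/
def APNormalII (q : ℕ → ℕ) (x : ℝ) : Prop :=
  ∀ k, 1 ≤ k → ∀ m, 1 ≤ m → ∀ r, r < m → MemNAPII q k m r x

/-- `x ∈ RN^{II}(Q)`: for all `k, m, r` the counts in `Υ_{Q,m,r}(x)` of any two blocks of
length `k` with respect to `Λ_{m,r}(Q)` have ratio tending to `1`. -/
def MemRNII (q : ℕ → ℕ) (x : ℝ) : Prop :=
  ∀ k, 1 ≤ k → ∀ m, 1 ≤ m → ∀ r, r < m → ∀ B₁ B₂ : Fin k → ℕ,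
    Tendsto (fun n =>
      (blockCount (lamQ q m r) (Ups q m r x) B₁ n : ℝ) /
      (blockCount (lamQ q m r) (Ups q m r x) B₂ n : ℝ)) atTop (𝓝 1)

/-- `S` (a set of positive integers) is almost closed under addition: for every `k ∈ S`,
the set `{x ∉ S : x + k ∈ S}` has asymptotic density `0`. -/
def AlmostClosed (S : Set ℕ) : Prop :=
  ∀ k ∈ S, Tendsto
    (fun t : ℕ => (((Finset.Icc 1 t).filter fun x => x ∉ S ∧ x + k ∈ S).card : ℝ) / t)
    atTop (𝓝 0)

/-- The sequence `u` of reals is uniformly distributed mod 1. -/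
def UDMod1 (u : ℕ → ℝ) : Prop :=
  ∀ a b : ℝ, 0 ≤ a → a < b → b ≤ 1 →
    Tendsto (fun N => (((Finset.range N).filter fun n => u n ∈ Set.Ico a b).card : ℝ) / N)
      atTop (𝓝 (b - a))

/-- `x ∈ DN(Q)`: `x` is `Q`-distribution normal. -/
def DistNormal (q : ℕ → ℕ) (x : ℝ) : Prop := UDMod1 fun n => TQ q n x

/-- `x ∈ DN_{Ab}(Q)`: `x` is AP `Q`-distribution abnormal. -/
def APDistAbnormal (q : ℕ → ℕ) (x : ℝ) : Prop :=
  ∀ m, 2 ≤ m → ∀ r, r < m → ¬ UDMod1 fun n => TQ q (m * n + r) x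

/-- `y ∈ D_{(x_n)}(Q)`: for every `ξ ∈ (0,1)`, the proportion of `n ≤ N` with
`fract (T_{Q,n}(y) - x_n) < ξ` tends to `1`. -/
def MemD (q : ℕ → ℕ) (xs : ℕ → ℝ) (y : ℝ) : Prop :=
  ∀ ξ : ℝ, 0 < ξ → ξ < 1 →
    Tendsto (fun N =>
      (((Finset.range N).filter fun n => Int.fract (TQ q n y - xs n) < ξ).card : ℝ) / N)
      atTop (𝓝 1)

/-- A computable real number. -/
def ComputableReal (x : ℝ) : Prop :=
  ∃ f : ℕ → ℕ, Computable f ∧ ∀ n : ℕ, 0 < n → (f n : ℝ) / n ≤ x ∧ x ≤ ((f n : ℝ) + 1) / n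

/-- The indicator function `1_{ℕ∖S}` of the complement of `S`, with values in `ℤ`. -/
noncomputable def indZ (S : Set ℕ) (i : ℕ) : ℤ := if i ∈ S then 0 else 1

/-- The indicator function `1_{ℕ∖S}` of the complement of `S`, with values in `ℝ`. -/
noncomputable def indR (S : Set ℕ) (i : ℕ) : ℝ := if i ∈ S then 0 else 1

/-- The coefficients `c_{t,i}`: `c_{t,1} = t (1+ε)^{1_{ℕ∖S}(1)}` and
`c_{t,i} = (1+ε)^{1_{ℕ∖S}(i) - 1_{ℕ∖S}(i-1)}` for `i ≥ 2`. -/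
noncomputable def coeff (S : Set ℕ) (ε : ℝ) (t i : ℕ) : ℝ :=
  if i = 1 then (t : ℝ) * (1 + ε) ^ indZ S 1
  else (1 + ε) ^ (indZ S i - indZ S (i - 1))

/-- `N_k(b)`: the set of real numbers normal of order `k` in base `b`. -/
def BaseNormalOfOrder (b k : ℕ) : Set ℝ :=
  {x | ∀ B : Fin k → ℕ, (∀ j, B j < b) →
    Tendsto (fun n => (blockCount (fun _ => b) x B n : ℝ) / n) atTop
      (𝓝 (((b : ℝ) ^ k)⁻¹))}

/-! ### Cantor series with prescribed digits -/

/-- The tail `∑_j E_{n+j} / (q_n ⋯ q_{n+j})` of a Cantor series. -/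
noncomputable def cantorTail (q E : ℕ → ℕ) (n : ℕ) : ℝ :=
  ∑' j : ℕ, (E (n + j) : ℝ) / ∏ i ∈ Finset.range (j + 1), (q (n + i) : ℝ)

section Digits

variable {q E : ℕ → ℕ}

lemma shiftProd_pos (hq : IsBasic q) (n j : ℕ) :
    0 < ∏ i ∈ Finset.range j, (q (n + i) : ℝ) :=
  Finset.prod_pos fun i _ => by exact_mod_cast (by have := hq (n + i); omega : 0 < q (n + i))

lemma cantorTail_partial_le (hq : IsBasic q) (hE : ∀ n, E n + 1 ≤ q n) (n J : ℕ) :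
    ∑ j ∈ Finset.range J, (E (n + j) : ℝ) / ∏ i ∈ Finset.range (j + 1), (q (n + i) : ℝ) ≤
      1 - (∏ i ∈ Finset.range J, (q (n + i) : ℝ))⁻¹ := by
  induction J with
  | zero => simp
  | succ J ih =>
    rw [Finset.sum_range_succ]
    have hP := shiftProd_pos hq n J
    have hqJ : (0 : ℝ) < q (n + J) := by
      exact_mod_cast (by have := hq (n + J); omega : 0 < q (n + J))
    have hEJ : (E (n + J) : ℝ) + 1 ≤ q (n + J) := by exact_mod_cast hE (n + J)
    have key : (E (n + J) : ℝ) / ∏ i ∈ Finset.range (J + 1), (q (n + i) : ℝ) ≤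
        (∏ i ∈ Finset.range J, (q (n + i) : ℝ))⁻¹ -
          (∏ i ∈ Finset.range (J + 1), (q (n + i) : ℝ))⁻¹ := by
      rw [Finset.prod_range_succ, le_sub_iff_add_le, inv_eq_one_div, ← add_div,
        div_le_iff₀ (by positivity), ← mul_assoc, inv_mul_cancel₀ hP.ne', one_mul]
      exact hEJ
    linarith

lemma cantorTail_summable (hq : IsBasic q) (hE : ∀ n, E n + 1 ≤ q n) (n : ℕ) :
    Summable fun j : ℕ => (E (n + j) : ℝ) / ∏ i ∈ Finset.range (j + 1), (q (n + i) : ℝ) :=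
  summable_of_sum_range_le (c := 1)
    (fun j => div_nonneg (Nat.cast_nonneg _) (shiftProd_pos hq n (j + 1)).le)
    fun J => (cantorTail_partial_le hq hE n J).trans
      (by linarith [inv_nonneg.mpr (shiftProd_pos hq n J).le])

lemma cantorTail_nonneg (hq : IsBasic q) (n : ℕ) : 0 ≤ cantorTail q E n :=
  tsum_nonneg fun j => div_nonneg (Nat.cast_nonneg _) (shiftProd_pos hq n (j + 1)).le

lemma cantorTail_le_one (hq : IsBasic q) (hE : ∀ n, E n + 1 ≤ q n) (n : ℕ) :
    cantorTail q E n ≤ 1 :=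
  Real.tsum_le_of_sum_range_le
    (fun j => div_nonneg (Nat.cast_nonneg _) (shiftProd_pos hq n (j + 1)).le)
    fun J => (cantorTail_partial_le hq hE n J).trans
      (by linarith [inv_nonneg.mpr (shiftProd_pos hq n J).le])

lemma mul_cantorTail (hq : IsBasic q) (hE : ∀ n, E n + 1 ≤ q n) (n : ℕ) :
    (q n : ℝ) * cantorTail q E n = E n + cantorTail q E (n + 1) := by
  have hqn : (0 : ℝ) < q n := by exact_mod_cast (by have := hq n; omega : 0 < q n)
  have hstep : ∀ j : ℕ, (E (n + (j + 1)) : ℝ) /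
      ∏ i ∈ Finset.range (j + 1 + 1), (q (n + i) : ℝ) =
      (q n : ℝ)⁻¹ * ((E (n + 1 + j) : ℝ) / ∏ i ∈ Finset.range (j + 1), (q (n + 1 + i) : ℝ)) := by
    intro j
    rw [Finset.prod_range_succ' _ (j + 1)]
    have h1 : ∀ i, n + (i + 1) = n + 1 + i := fun i => by ring
    rw [Finset.prod_congr rfl fun i _ => by rw [h1 i], add_zero, h1 j]
    have := shiftProd_pos hq (n + 1) (j + 1)
    field_simp
  rw [cantorTail, (cantorTail_summable hq hE n).tsum_eq_zero_add]
  simp only [hstep, tsum_mul_left]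
  rw [← cantorTail]
  simp
  field_simp

lemma cantorTail_le (hq : IsBasic q) (hE : ∀ n, E n + 2 ≤ q n) (n : ℕ) :
    cantorTail q E n ≤ 1 - (q n : ℝ)⁻¹ := by
  have hE' : ∀ n, E n + 1 ≤ q n := fun n => by have := hE n; omega
  have hqn : (0 : ℝ) < q n := by exact_mod_cast (by have := hq n; omega : 0 < q n)
  have h1 := mul_cantorTail hq hE' n
  have h2 := cantorTail_le_one hq hE' (n + 1)
  have h3 : (E n : ℝ) + 2 ≤ q n := by exact_mod_cast hE n
  have h4 : (q n : ℝ) * (q n : ℝ)⁻¹ = 1 := mul_inv_cancel₀ hqn.ne'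
  have : (q n : ℝ) * cantorTail q E n ≤ q n * (1 - (q n : ℝ)⁻¹) := by
    rw [mul_sub, h4]; linarith
  exact le_of_mul_le_mul_left this hqn

lemma cantorTail_lt_one (hq : IsBasic q) (hE : ∀ n, E n + 2 ≤ q n) (n : ℕ) :
    cantorTail q E n < 1 := by
  have hqn : (0 : ℝ) < q n := by exact_mod_cast (by have := hq n; omega : 0 < q n)
  have := cantorTail_le hq hE n
  have := inv_pos.mpr hqn
  linarith

lemma qprod_succ (q : ℕ → ℕ) (n : ℕ) : qprod q (n + 1) = qprod q n * q n :=
  Finset.prod_range_succ _ _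

lemma qprod_mul_cantorTail (hq : IsBasic q) (hE : ∀ n, E n + 1 ≤ q n) (n : ℕ) :
    ∃ K : ℤ, qprod q n * cantorTail q E 0 = K + cantorTail q E n := by
  induction n with
  | zero => exact ⟨0, by simp [qprod]⟩
  | succ n ih =>
    obtain ⟨K, hK⟩ := ih
    refine ⟨q n * K + E n, ?_⟩
    rw [qprod_succ, mul_right_comm, hK, add_mul, mul_comm (cantorTail q E n),
      mul_cantorTail hq hE]
    push_cast
    ring

/-- If all digits satisfy `E_n ≤ q_n - 2`, the Cantor series with digits `E` has `T_{Q,n}` equal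
to its `n`-th tail. -/
lemma TQ_cantorTail (hq : IsBasic q) (hE : ∀ n, E n + 2 ≤ q n) (n : ℕ) :
    TQ q n (cantorTail q E 0) = cantorTail q E n := by
  obtain ⟨K, hK⟩ := qprod_mul_cantorTail (E := E) hq (fun n => by have := hE n; omega) n
  rw [TQ, hK, Int.fract_intCast_add, Int.fract_eq_self]
  exact ⟨cantorTail_nonneg hq n, cantorTail_lt_one hq hE n⟩

lemma qdigit_cantorTail (hq : IsBasic q) (hE : ∀ n, E n + 2 ≤ q n) (n : ℕ) :
    qdigit q (cantorTail q E 0) n = E n := by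
  rw [qdigit, TQ_cantorTail hq hE, mul_cantorTail hq (fun n => by have := hE n; omega)]
  rw [Nat.floor_eq_iff (add_nonneg (Nat.cast_nonneg _) (cantorTail_nonneg hq _))]
  constructor
  · linarith [cantorTail_nonneg (E := E) hq (n + 1)]
  · linarith [cantorTail_lt_one hq hE (n + 1)]

/-- The digits of `Υ_{Q,m,r}(x)` are the digits of `x` along the residue class. -/
lemma qdigit_Ups {x : ℝ} (hq : IsBasic q) (hx : ∀ n, qdigit q x n + 2 ≤ q n) (m r t : ℕ) :
    qdigit (lamQ q m r) (Ups q m r x) t = qdigit q x (m * t + r) := by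
  have hU : Ups q m r x = cantorTail (lamQ q m r) (fun t => qdigit q x (m * t + r)) 0 := by
    simp only [Ups, cantorTail, zero_add]
  exact hU ▸ qdigit_cantorTail (q := lamQ q m r) (fun t => hq _) (fun t => hx _) t

end Digits

/-! ### The digit expansion of a real number -/

section Expansion

variable {a : ℕ → ℕ}

lemma TQ_nonneg (a : ℕ → ℕ) (n : ℕ) (y : ℝ) : 0 ≤ TQ a n y := Int.fract_nonneg _

lemma TQ_lt_one (a : ℕ → ℕ) (n : ℕ) (y : ℝ) : TQ a n y < 1 := Int.fract_lt_one _

lemma qdigit_lt (ha : ∀ n, 1 ≤ a n) (y : ℝ) (n : ℕ) : qdigit a y n < a n := by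
  have h : (0 : ℝ) < a n := by exact_mod_cast ha n
  rw [qdigit, Nat.floor_lt (mul_nonneg h.le (TQ_nonneg a n y))]
  nlinarith [TQ_lt_one a n y]

lemma TQ_succ (a : ℕ → ℕ) (n : ℕ) (y : ℝ) : TQ a (n + 1) y = a n * TQ a n y - qdigit a y n := by
  have h0 : (0 : ℝ) ≤ a n * TQ a n y := mul_nonneg (Nat.cast_nonneg _) (TQ_nonneg a n y)
  have h1 : ((qdigit a y n : ℕ) : ℝ) = (⌊(a n : ℝ) * TQ a n y⌋ : ℤ) := by
    rw [qdigit, ← Int.natCast_floor_eq_floor h0]; simp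
  rw [h1, Int.self_sub_floor]
  have h2 : qprod a (n + 1) * y = ((a n : ℤ) * ⌊qprod a n * y⌋ : ℤ) + a n * TQ a n y := by
    rw [qprod_succ, TQ, Int.fract]
    push_cast
    ring
  rw [TQ, h2, Int.fract_intCast_add]

lemma qprod_mul_sub_of_agree {y y' : ℝ} (hy : y ∈ Set.Ico (0 : ℝ) 1)
    (hy' : y' ∈ Set.Ico (0 : ℝ) 1) {N : ℕ} (h : ∀ n < N, qdigit a y n = qdigit a y' n) :
    qprod a N * (y - y') = TQ a N y - TQ a N y' := by
  induction N with
  | zero =>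
    simp [qprod, TQ, Int.fract_eq_self.mpr hy, Int.fract_eq_self.mpr hy']
  | succ N ih =>
    rw [TQ_succ, TQ_succ, h N N.lt_succ_self, qprod_succ]
    have := ih fun n hn => h n (by omega)
    linear_combination (a N : ℝ) * this

lemma qprod_pos (ha : ∀ n, 1 ≤ a n) (n : ℕ) : 0 < qprod a n :=
  Finset.prod_pos fun i _ => by exact_mod_cast ha i

lemma abs_sub_le_of_agree (ha : ∀ n, 1 ≤ a n) {y y' : ℝ} (hy : y ∈ Set.Ico (0 : ℝ) 1)
    (hy' : y' ∈ Set.Ico (0 : ℝ) 1) {N : ℕ} (h : ∀ n < N, qdigit a y n = qdigit a y' n) :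
    |y - y'| ≤ (qprod a N)⁻¹ := by
  have h1 := qprod_mul_sub_of_agree hy hy' h
  have hP := qprod_pos ha N
  have h2 : |y - y'| * qprod a N = |TQ a N y - TQ a N y'| := by
    rw [← h1, abs_mul, abs_of_pos hP, mul_comm]
  rw [inv_eq_one_div, le_div_iff₀ hP, h2, abs_le]
  constructor <;> linarith [TQ_nonneg a N y, TQ_nonneg a N y', TQ_lt_one a N y, TQ_lt_one a N y']

/-- Two Cantor series with digits `≤ q_n - 2` first differing at position `N` are far apart. -/
lemma le_abs_cantorTail_sub {q E E' : ℕ → ℕ} (hq : IsBasic q) (hE : ∀ n, E n + 2 ≤ q n)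
    (hE' : ∀ n, E' n + 2 ≤ q n) {N : ℕ} (h : ∀ n < N, E n = E' n) (hN : E N ≠ E' N) :
    (qprod q (N + 2))⁻¹ ≤ |cantorTail q E 0 - cantorTail q E' 0| := by
  wlog hlt : E N < E' N generalizing E E'
  · rw [abs_sub_comm]
    exact this hE' hE (fun n hn => (h n hn).symm) hN.symm (by omega)
  have e1 : ∀ {F : ℕ → ℕ}, (∀ n, F n + 2 ≤ q n) → ∀ n, F n + 1 ≤ q n :=
    fun hF n => by have := hF n; omega
  have key : ∀ M ≤ N, qprod q M * (cantorTail q E' 0 - cantorTail q E 0) =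
      cantorTail q E' M - cantorTail q E M := by
    intro M hM
    induction M with
    | zero => simp [qprod]
    | succ M ih =>
      have h1 := mul_cantorTail hq (e1 hE) M
      have h2 := mul_cantorTail hq (e1 hE') M
      have h3 := ih (by omega)
      rw [h M (by omega)] at h1
      rw [qprod_succ]
      linear_combination (q M : ℝ) * h3 + h2 - h1
  have h1 := mul_cantorTail hq (e1 hE) N
  have h2 := mul_cantorTail hq (e1 hE') N
  have h3 := key N le_rfl
  have h4 := cantorTail_le hq hE (N + 1)
  have h5 := cantorTail_nonneg (E := E') hq (N + 1)
  have h6 : (E N : ℝ) + 1 ≤ E' N := by exact_mod_cast hlt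
  have hq1 : ∀ n, 1 ≤ q n := fun n => by have := hq n; omega
  have hP := qprod_pos hq1 (N + 1)
  have hqN : (0 : ℝ) < q (N + 1) := by exact_mod_cast hq1 (N + 1)
  have h7 : (q (N + 1) : ℝ)⁻¹ ≤ qprod q (N + 1) * (cantorTail q E' 0 - cantorTail q E 0) := by
    rw [qprod_succ, mul_right_comm, h3]
    linarith [h1, h2]
  rw [abs_sub_comm]
  refine le_trans ?_ (le_abs_self _)
  rw [qprod_succ q (N + 1), mul_inv, inv_mul_le_iff₀ hP]
  exact h7

end Expansion

/-! ### Hausdorff dimension of digit-restricted sets -/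

/-- The set of sums of Cantor series whose `n`-th digit ranges over `{c_n, …, c_n + a_n - 1}`. -/
def cantorDigitSet (q c a : ℕ → ℕ) : Set ℝ :=
  {x | ∃ E : ℕ → ℕ, (∀ n, c n ≤ E n ∧ E n < c n + a n) ∧ x = cantorTail q E 0}

lemma le_dimH_cantorDigitSet {q c a : ℕ → ℕ} (hq : IsBasic q) (ha : ∀ n, 1 ≤ a n)
    (hca : ∀ n, c n + a n + 1 ≤ q n) (hinf : Tendsto (qprod a) atTop atTop)
    {r : NNReal} (hr : 0 < r) {C : NNReal}
    (hC : ∀ n, qprod q (n + 2) ^ (r : ℝ) ≤ C * qprod a n) :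
    (r : ENNReal) ≤ dimH (cantorDigitSet q c a) := by
  set g : ℝ → ℝ := fun y => cantorTail q (fun n => c n + qdigit a y n) 0 with hg
  set I : Set ℝ := Set.Ico 0 1 with hI
  have hEle : ∀ y n, c n + qdigit a y n + 2 ≤ q n := fun y n => by
    have := qdigit_lt ha y n; have := hca n; omega
  have hq1 : ∀ n, 1 ≤ q n := fun n => by have := hq n; omega
  have hmain : ∀ y ∈ I, ∀ y' ∈ I, |y - y'| ≤ C * |g y - g y'| ^ (r : ℝ) := by
    intro y hy y' hy'
    by_cases hall : ∀ n, qdigit a y n = qdigit a y' n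
    · have h0 : |y - y'| ≤ 0 := by
        refine ge_of_tendsto' (tendsto_inv_atTop_zero.comp hinf) fun N => ?_
        exact abs_sub_le_of_agree ha hy hy' fun n _ => hall n
      exact h0.trans (by positivity)
    · push Not at hall
      have hN := Nat.find_spec hall
      have hlt : ∀ n < Nat.find hall, qdigit a y n = qdigit a y' n := fun n hn => by
        by_contra hcon; exact Nat.find_min hall hn hcon
      set N := Nat.find hall
      have h1 := abs_sub_le_of_agree ha hy hy' hlt
      have h2 := le_abs_cantorTail_sub hq (hEle y) (hEle y') (N := N)
        (fun n hn => by simp [hlt n hn]) (by simpa using hN)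
      have hPa := qprod_pos ha N
      have hPq := qprod_pos hq1 (N + 2)
      calc |y - y'| ≤ (qprod a N)⁻¹ := h1
        _ ≤ C * (qprod q (N + 2) ^ (r : ℝ))⁻¹ := by
            have hpos : 0 < qprod q (N + 2) ^ (r : ℝ) := Real.rpow_pos_of_pos hPq _
            rw [← div_eq_mul_inv, le_div_iff₀ hpos, inv_mul_le_iff₀ hPa, mul_comm]
            exact hC N
        _ = C * ((qprod q (N + 2))⁻¹) ^ (r : ℝ) := by rw [Real.inv_rpow hPq.le]
        _ ≤ C * |g y - g y'| ^ (r : ℝ) := by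
            gcongr
  have hinj : Set.InjOn g I := by
    intro y hy y' hy' h
    have := hmain y hy y' hy'
    rw [h, sub_self, abs_zero, Real.zero_rpow (by exact_mod_cast hr.ne'), mul_zero] at this
    exact sub_eq_zero.mp (abs_nonpos_iff.mp this)
  have hold : HolderOnWith C r (Function.invFunOn g I) (g '' I) := by
    rintro _ ⟨y, hy, rfl⟩ _ ⟨y', hy', rfl⟩
    rw [hinj.leftInvOn_invFunOn hy, hinj.leftInvOn_invFunOn hy', edist_dist, edist_dist,
      Real.dist_eq, Real.dist_eq]
    rw [ENNReal.ofReal_rpow_of_nonneg (abs_nonneg _) r.coe_nonneg, ← ENNReal.ofReal_coe_nnreal,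
      ← ENNReal.ofReal_mul C.coe_nonneg]
    exact ENNReal.ofReal_le_ofReal (hmain y hy y' hy')
  have himg : Function.invFunOn g I '' (g '' I) = I := by
    rw [Set.image_image]
    refine (Set.image_congr fun y hy => hinj.leftInvOn_invFunOn hy).trans (Set.image_id' I)
  have hdI : dimH I = 1 := by
    rw [Real.dimH_of_nonempty_interior]
    · simp
    · rw [hI, interior_Ico]; exact ⟨1 / 2, by norm_num, by norm_num⟩
  have hle := hold.dimH_image_le hr
  rw [himg, hdI] at hle
  have hsub : g '' I ⊆ cantorDigitSet q c a := by
    rintro _ ⟨y, hy, rfl⟩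
    exact ⟨_, fun n => ⟨by simp, by simpa using qdigit_lt ha y n⟩, rfl⟩
  refine le_trans ?_ (dimH_mono hsub)
  have hr0 : (r : ENNReal) ≠ 0 := by exact_mod_cast hr.ne'
  rw [ENNReal.le_div_iff_mul_le (Or.inl hr0) (Or.inl ENNReal.coe_ne_top), one_mul] at hle
  exact hle

/-! ### Ratios of partial sums, computed block by block -/

section CycleRatio

lemma sum_range_eq_add_sum_Ico (g : ℕ → ℝ) {X : ℕ → ℕ} (hX : StrictMono X) (c : ℕ) :
    ∑ n ∈ Finset.range (X c), g n = ∑ n ∈ Finset.range (X 0), g n +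
      ∑ d ∈ Finset.range c, ∑ n ∈ Finset.Ico (X d) (X (d + 1)), g n := by
  induction c with
  | zero => simp
  | succ c ih =>
    rw [Finset.sum_range_succ, ← add_assoc, ← ih,
      Finset.sum_range_add_sum_Ico _ (hX.monotone c.le_succ)]

lemma tendsto_sum_of_half_le {γ : ℕ → ℝ} (hlow : ∀ᶠ c in atTop, 1 / 2 ≤ γ c) :
    ∃ K : ℝ, ∀ c : ℕ, (c : ℝ) / 2 - K ≤ ∑ d ∈ Finset.range c, γ d := by
  obtain ⟨c₀, hc₀⟩ := eventually_atTop.mp hlow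
  refine ⟨(c₀ : ℝ) / 2 + ∑ d ∈ Finset.range c₀, |γ d|, fun c => ?_⟩
  rcases le_total c c₀ with h | h
  · have h1 : -∑ d ∈ Finset.range c₀, |γ d| ≤ ∑ d ∈ Finset.range c, γ d := by
      calc -∑ d ∈ Finset.range c₀, |γ d| ≤ -∑ d ∈ Finset.range c, |γ d| := by
            gcongr
        _ ≤ -|∑ d ∈ Finset.range c, γ d| := neg_le_neg (Finset.abs_sum_le_sum_abs _ _)
        _ ≤ _ := neg_abs_le _
    have : (c : ℝ) ≤ c₀ := by exact_mod_cast h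
    linarith
  · induction c, h using Nat.le_induction with
    | base =>
      have := neg_abs_le (∑ d ∈ Finset.range c₀, γ d)
      have := Finset.abs_sum_le_sum_abs γ (Finset.range c₀)
      linarith
    | succ c hc ih =>
      rw [Finset.sum_range_succ]
      have := hc₀ c hc
      push_cast
      linarith

/-- If the sums of `g₁` and `g₂ ≥ 0` over consecutive blocks `[X_c, X_{c+1})` have ratio tending
to `L`, and the block sums of `g₂` are bounded below and are `o(c)`, then the ratio of the partial
sums tends to `L`. -/
lemma tendsto_ratio_of_blocks {g₁ g₂ : ℕ → ℝ} (h₁ : ∀ n, 0 ≤ g₁ n) (h₂ : ∀ n, 0 ≤ g₂ n)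
    {X : ℕ → ℕ} (hX : StrictMono X) {L : ℝ}
    (hL : Tendsto (fun c => (∑ n ∈ Finset.Ico (X c) (X (c + 1)), g₁ n) /
      ∑ n ∈ Finset.Ico (X c) (X (c + 1)), g₂ n) atTop (𝓝 L))
    (hlow : ∀ᶠ c in atTop, 1 / 2 ≤ ∑ n ∈ Finset.Ico (X c) (X (c + 1)), g₂ n)
    (hup : Tendsto (fun c : ℕ => (∑ n ∈ Finset.Ico (X c) (X (c + 1)), g₂ n) / c) atTop (𝓝 0)) :
    Tendsto (fun N => (∑ n ∈ Finset.range N, g₁ n) / ∑ n ∈ Finset.range N, g₂ n) atTop (𝓝 L) ∧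
      Tendsto (fun N => ∑ n ∈ Finset.range N, g₂ n) atTop atTop := by
  set γ₁ : ℕ → ℝ := fun c => ∑ n ∈ Finset.Ico (X c) (X (c + 1)), g₁ n with hγ₁
  set γ₂ : ℕ → ℝ := fun c => ∑ n ∈ Finset.Ico (X c) (X (c + 1)), g₂ n with hγ₂
  set W : ℕ → ℝ := fun c => ∑ d ∈ Finset.range c, γ₂ d with hW
  set U : ℕ → ℝ := fun N => ∑ n ∈ Finset.range N, g₁ n with hU
  set V : ℕ → ℝ := fun N => ∑ n ∈ Finset.range N, g₂ n with hV
  have hUX : ∀ c, U (X c) = U (X 0) + ∑ d ∈ Finset.range c, γ₁ d :=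
    sum_range_eq_add_sum_Ico g₁ hX
  have hVX : ∀ c, V (X c) = V (X 0) + W c := sum_range_eq_add_sum_Ico g₂ hX
  have hUm : Monotone U := fun a b hab =>
    Finset.sum_le_sum_of_subset_of_nonneg (Finset.range_mono hab) fun i _ _ => h₁ i
  have hVm : Monotone V := fun a b hab =>
    Finset.sum_le_sum_of_subset_of_nonneg (Finset.range_mono hab) fun i _ _ => h₂ i
  obtain ⟨K, hK⟩ := tendsto_sum_of_half_le hlow
  have hcast : Tendsto (fun c : ℕ => (c : ℝ)) atTop atTop := tendsto_natCast_atTop_atTop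
  have hWtop : Tendsto W atTop atTop :=
    tendsto_atTop_mono hK (tendsto_atTop_add_const_right _ (-K)
      (hcast.atTop_div_const (by norm_num)))
  have hWpos : ∀ᶠ c in atTop, 0 < W c := hWtop.eventually_gt_atTop 0
  have hγW : Tendsto (fun c => γ₂ c / W c) atTop (𝓝 0) := by
    have h4 : Tendsto (fun c : ℕ => 4 * (γ₂ c / c)) atTop (𝓝 0) := by simpa using hup.const_mul 4
    refine squeeze_zero' ?_ ?_ h4
    · filter_upwards [hWpos] with c hc
      exact div_nonneg (Finset.sum_nonneg fun i _ => h₂ i) hc.le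
    · filter_upwards [hWpos, hcast.eventually_ge_atTop (4 * K), eventually_gt_atTop 0]
        with c hc hc4 hc0
      have hc0' : (0 : ℝ) < c := by exact_mod_cast hc0
      rw [mul_div_assoc', div_le_div_iff₀ hc hc0']
      have h5 : (0 : ℝ) ≤ γ₂ c := Finset.sum_nonneg fun i _ => h₂ i
      have h6 : (c : ℝ) ≤ 4 * W c := by have := hK c; simp only [hW]; linarith
      nlinarith
  have hsum : Tendsto (fun c => (∑ d ∈ Finset.range c, γ₁ d) / W c) atTop (𝓝 L) := by
    have hlo : (fun c => γ₁ c - L * γ₂ c) =o[atTop] γ₂ := by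
      refine (Asymptotics.isLittleO_iff_tendsto' ?_).mpr ?_
      · filter_upwards [hlow] with c hc h0
        simp only [hγ₂] at h0; rw [h0] at hc; norm_num at hc
      · have : Tendsto (fun c => γ₁ c / γ₂ c - L) atTop (𝓝 0) := by
          simpa using hL.sub_const L
        refine this.congr' ?_
        filter_upwards [hlow] with c hc
        have : γ₂ c ≠ 0 := by simp only [hγ₂]; intro h; rw [h] at hc; norm_num at hc
        field_simp
    have h7 :=
      (hlo.sum_range (fun c => Finset.sum_nonneg fun i _ => h₂ i) hWtop).tendsto_div_nhds_zero
    have h8 : Tendsto (fun c => (∑ d ∈ Finset.range c, (γ₁ d - L * γ₂ d)) / W c + L) atTop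
        (𝓝 L) := by simpa using h7.add_const L
    refine h8.congr' ?_
    filter_upwards [hWpos] with c hc
    rw [Finset.sum_sub_distrib, ← Finset.mul_sum]
    simp only [hW] at hc ⊢
    field_simp
    ring
  have hUW : Tendsto (fun c => U (X c) / W c) atTop (𝓝 L) := by
    have h9 : Tendsto (fun c => U (X 0) / W c) atTop (𝓝 0) := hWtop.const_div_atTop _
    refine (by simpa using h9.add hsum : Tendsto _ _ (𝓝 L)).congr fun c => ?_
    rw [hUX c, add_div]
  have hVW : Tendsto (fun c => V (X c) / W c) atTop (𝓝 1) := by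
    have h9 : Tendsto (fun c => V (X 0) / W c) atTop (𝓝 0) := hWtop.const_div_atTop _
    have h10 : Tendsto (fun c => V (X 0) / W c + 1) atTop (𝓝 1) := by simpa using h9.add_const 1
    refine h10.congr' ?_
    filter_upwards [hWpos] with c hc
    rw [hVX c, add_div, div_self hc.ne']
  have hWW : Tendsto (fun c => W (c + 1) / W c) atTop (𝓝 1) := by
    have h10 : Tendsto (fun c => 1 + γ₂ c / W c) atTop (𝓝 1) := by simpa using hγW.const_add 1
    refine h10.congr' ?_
    filter_upwards [hWpos] with c hc
    simp only [hW, Finset.sum_range_succ] at hc ⊢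
    rw [add_div, div_self hc.ne']
  have hsucc : Tendsto (fun c : ℕ => c + 1) atTop atTop := tendsto_add_atTop_nat 1
  have hWpos' := hsucc.eventually hWpos
  have hupper : Tendsto (fun c => U (X (c + 1)) / V (X c)) atTop (𝓝 L) := by
    have := ((hUW.comp hsucc).mul hWW).div hVW one_ne_zero
    rw [mul_one, div_one] at this
    refine this.congr' ?_
    filter_upwards [hWpos, hWpos'] with c hc hc'
    simp only [Function.comp, Pi.div_apply]
    field_simp
  have hlower : Tendsto (fun c => U (X c) / V (X (c + 1))) atTop (𝓝 L) := by
    have := (hUW.div (hVW.comp hsucc) one_ne_zero).div hWW one_ne_zero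
    rw [div_one, div_one] at this
    refine this.congr' ?_
    filter_upwards [hWpos, hWpos'] with c hc hc'
    simp only [Function.comp, Pi.div_apply]
    field_simp
  have hVtop : Tendsto V atTop atTop := by
    refine tendsto_atTop_atTop_of_monotone hVm fun b => ?_
    obtain ⟨c, hc⟩ := (hWtop.eventually_ge_atTop (b - V (X 0))).exists
    exact ⟨X c, by rw [hVX c]; linarith⟩
  refine ⟨?_, hVtop⟩
  set κ : ℕ → ℕ := fun N => Nat.findGreatest (fun c => X c ≤ N) N with hκ
  have hκtop : Tendsto κ atTop atTop := by
    refine tendsto_atTop_atTop.mpr fun c => ⟨X c, fun N hN => ?_⟩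
    exact Nat.le_findGreatest ((hX.id_le c).trans hN) hN
  have hκ1 : ∀ᶠ N in atTop, X (κ N) ≤ N := by
    filter_upwards [eventually_ge_atTop (X 0)] with N hN
    exact Nat.findGreatest_spec (P := fun c => X c ≤ N) (Nat.zero_le N) hN
  have hκ2 : ∀ N, N < X (κ N + 1) := by
    intro N
    by_contra hcon
    push Not at hcon
    have := Nat.le_findGreatest (P := fun c => X c ≤ N) ((hX.id_le _).trans hcon) hcon
    exact absurd this (Nat.not_succ_le_self _)
  have hU0 : ∀ N, 0 ≤ U N := fun N => Finset.sum_nonneg fun i _ => h₁ i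
  have hVpos : ∀ᶠ c in atTop, 0 < V (X c) :=
    (hVtop.comp hX.tendsto_atTop).eventually_gt_atTop 0
  refine tendsto_of_tendsto_of_tendsto_of_le_of_le' (hlower.comp hκtop) (hupper.comp hκtop) ?_ ?_
  · filter_upwards [hκ1, hVtop.eventually_gt_atTop 0] with N hN hVN
    exact div_le_div₀ (hU0 _) (hUm hN) hVN (hVm (hκ2 N).le)
  · filter_upwards [hκ1, hκtop.eventually hVpos] with N hN hVN
    exact div_le_div₀ (hU0 _) (hUm (hκ2 N).le) hVN (hVm hN)

end CycleRatio

/-! ### The layout of positions and the construction -/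

section Layout

open Nat (factorial)

/-- The base used at level `C`; it tends to infinity so slowly that `b ^ (5 b + 4) ≤ C`. -/
noncomputable def stage (C : ℕ) : ℕ := max 2 (Nat.findGreatest (fun b => b ^ (5 * b + 4) ≤ C) C)

/-- The index `C` of the cycle `[C!, (C+1)!)` containing `n`. -/
noncomputable def cyc (n : ℕ) : ℕ := Nat.findGreatest (fun c => c.factorial ≤ n) n

/-- The index of the slot (a run of `(cyc n)!` positions) containing `n` in its cycle. -/
noncomputable def slot (n : ℕ) : ℕ := n / (cyc n).factorial - 1

/-- The position of `n` in its slot. -/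
noncomputable def off (n : ℕ) : ℕ := n % (cyc n).factorial

/-- The base governing the cycle of `n`. -/
noncomputable def base (n : ℕ) : ℕ := stage (cyc n / 2)

/-- The number of slots in which the offset `o` is active. -/
def wordCount (b o : ℕ) : ℕ := b ^ b * b ^ (4 * (b - o))

/-- The weight of words of length `l`. -/
noncomputable def kap (S : Set ℕ) (l : ℕ) : ℕ := if l ∈ S then 1 else 2

/-- Positions with a small entry of the basic sequence. -/
def IsD (S : Set ℕ) (n : ℕ) : Prop :=
  cyc n % 2 = 1 ∧ off n < base n ∧ slot n < kap S (off n + 1) * wordCount (base n) (off n)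

/-- Positions with a small digit. -/
def IsA (n : ℕ) : Prop :=
  cyc n % 2 = 0 ∧ 1 ≤ off n ∧ off n ≤ base n ∧ slot n < wordCount (base n) (off n - 1)

/-- The van der Corput numbering of residues modulo `M!`. -/
def corput : ℕ → ℕ → ℕ
  | 0, _ => 0
  | M + 1, n => (M + 1) * corput M n + n / M.factorial % (M + 1)

/-- The basic sequence. -/
noncomputable def seqQ (S : Set ℕ) (n : ℕ) : ℕ :=
  if IsD S n then base n else 2 ^ n * ((cyc n).factorial + 2)

/-- The least admissible digit. -/
noncomputable def lowDigit (S : Set ℕ) (n : ℕ) : ℕ :=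
  if IsD S n then base n - 2
  else if IsA n then slot n / base n ^ (off n - 1) % base n
  else 2 ^ n * (1 + corput (cyc n) n)

/-- The number of admissible digits. -/
noncomputable def numDigits (S : Set ℕ) (n : ℕ) : ℕ := if IsD S n ∨ IsA n then 1 else 2 ^ n

lemma two_le_stage (C : ℕ) : 2 ≤ stage C := le_max_left _ _

lemma stage_le (C : ℕ) : stage C ≤ max 2 C := max_le_max le_rfl (Nat.findGreatest_le C)

lemma tendsto_stage : Tendsto stage atTop atTop := by
  refine tendsto_atTop_atTop.mpr fun b => ⟨max b (b ^ (5 * b + 4)), fun C hC => ?_⟩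
  exact (Nat.le_findGreatest (P := fun b => b ^ (5 * b + 4) ≤ C) ((le_max_left _ _).trans hC)
    ((le_max_right _ _).trans hC)).trans (le_max_right _ _)

lemma stage_pow_le : ∀ᶠ C in atTop, stage C ^ (5 * stage C + 4) ≤ C := by
  filter_upwards [eventually_ge_atTop (max 2 (2 ^ (5 * 2 + 4)))] with C hC
  have h2 : 2 ≤ Nat.findGreatest (fun b => b ^ (5 * b + 4) ≤ C) C :=
    Nat.le_findGreatest (P := fun b => b ^ (5 * b + 4) ≤ C) ((le_max_left _ _).trans hC)
    ((le_max_right _ _).trans hC)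
  have h3 : stage C = Nat.findGreatest (fun b => b ^ (5 * b + 4) ≤ C) C := max_eq_right h2
  rw [h3]
  exact Nat.findGreatest_spec (P := fun b => b ^ (5 * b + 4) ≤ C) ((le_max_left _ _).trans hC)
    ((le_max_right _ _).trans hC)

lemma le_cyc {c n : ℕ} (h : c.factorial ≤ n) : c ≤ cyc n :=
  Nat.le_findGreatest (P := fun c => c.factorial ≤ n) ((Nat.self_le_factorial c).trans h) h

lemma factorial_cyc_le {n : ℕ} (hn : 1 ≤ n) : (cyc n).factorial ≤ n :=
  Nat.findGreatest_spec (P := fun c => c.factorial ≤ n) (Nat.zero_le n) (by simpa using hn)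

lemma lt_factorial_cyc (n : ℕ) : n < (cyc n + 1).factorial := by
  by_contra h
  have := le_cyc (not_lt.mp h)
  omega

lemma tendsto_cyc : Tendsto cyc atTop atTop :=
  tendsto_atTop_atTop.mpr fun b => ⟨b.factorial, fun _ h => le_cyc h⟩

lemma cyc_eq {C n : ℕ} (h1 : C.factorial ≤ n) (h2 : n < (C + 1).factorial) : cyc n = C := by
  refine le_antisymm ?_ (le_cyc h1)
  by_contra h
  have h3 : (C + 1).factorial ≤ (cyc n).factorial := Nat.factorial_le (by omega)
  have h4 : 1 ≤ n := (Nat.factorial_pos C).trans_le h1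
  have := factorial_cyc_le h4
  omega

lemma layout {C i o : ℕ} (hi : i < C) (ho : o < C.factorial) :
    cyc ((i + 1) * C.factorial + o) = C ∧ slot ((i + 1) * C.factorial + o) = i ∧
      off ((i + 1) * C.factorial + o) = o := by
  have hP := Nat.factorial_pos C
  have h1 : cyc ((i + 1) * C.factorial + o) = C := by
    refine cyc_eq ?_ ?_
    · nlinarith
    · rw [Nat.factorial_succ]
      calc (i + 1) * C.factorial + o < (i + 1) * C.factorial + C.factorial := by omega
        _ = (i + 2) * C.factorial := by ring
        _ ≤ (C + 1) * C.factorial := Nat.mul_le_mul_right _ (by omega)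
  refine ⟨h1, ?_, ?_⟩
  · rw [slot, h1, add_comm, Nat.add_mul_div_right _ _ hP, Nat.div_eq_of_lt ho]; omega
  · rw [off, h1, add_comm, Nat.add_mul_mod_self_right, Nat.mod_eq_of_lt ho]

lemma sum_range_mul_eq {M : Type*} [AddCommMonoid M] (F : ℕ → M) (a P : ℕ) :
    ∑ n ∈ Finset.range (a * P), F n =
      ∑ i ∈ Finset.range a, ∑ o ∈ Finset.range P, F (i * P + o) := by
  induction a with
  | zero => simp
  | succ a ih => rw [Nat.succ_mul, Finset.sum_range_add, ih, Finset.sum_range_succ]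

lemma sum_cycle {M : Type*} [AddCommMonoid M] (F : ℕ → M) (C : ℕ) :
    ∑ n ∈ Finset.Ico C.factorial (C + 1).factorial, F n =
      ∑ o ∈ Finset.range C.factorial, ∑ i ∈ Finset.range C, F ((i + 1) * C.factorial + o) := by
  rw [Finset.sum_Ico_eq_sum_range, Finset.sum_comm]
  have h : (C + 1).factorial - C.factorial = C * C.factorial := by
    rw [Nat.factorial_succ, Nat.succ_mul, Nat.add_sub_cancel]
  rw [h, sum_range_mul_eq]
  refine Finset.sum_congr rfl fun i _ => Finset.sum_congr rfl fun o _ => ?_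
  congr 1; ring

lemma corput_lt (M n : ℕ) : corput M n < M.factorial := by
  induction M with
  | zero => simp [corput]
  | succ M ih =>
    rw [corput, Nat.factorial_succ]
    have : n / M.factorial % (M + 1) < M + 1 := Nat.mod_lt _ (by omega)
    nlinarith

lemma not_isA_of_isD {S : Set ℕ} {n : ℕ} (h : IsD S n) : ¬ IsA n := fun h' => by
  have := h.1; have := h'.1; omega

lemma two_le_base (n : ℕ) : 2 ≤ base n := two_le_stage _

lemma base_le (n : ℕ) : base n ≤ (cyc n).factorial + 1 := by
  refine (stage_le _).trans (max_le ?_ ?_)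
  · have := Nat.factorial_pos (cyc n); omega
  · have := Nat.self_le_factorial (cyc n); omega

lemma lowDigit_add_le (S : Set ℕ) (n : ℕ) : lowDigit S n + numDigits S n + 1 ≤ seqQ S n := by
  have hb := two_le_base n
  have hb' := base_le n
  have h2 : 1 ≤ 2 ^ n := Nat.one_le_two_pow
  by_cases hD : IsD S n
  · simp only [lowDigit, numDigits, seqQ, hD, if_true, true_or]; omega
  by_cases hA : IsA n
  · simp only [lowDigit, numDigits, seqQ, hD, hA, if_true, if_false, or_true]
    have : slot n / base n ^ (off n - 1) % base n < base n := Nat.mod_lt _ (by omega)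
    nlinarith
  · simp only [lowDigit, numDigits, seqQ, hD, hA, if_false, or_self]
    have := corput_lt (cyc n) n
    nlinarith

lemma numDigits_pos (S : Set ℕ) (n : ℕ) : 1 ≤ numDigits S n := by
  unfold numDigits; split_ifs
  · exact le_rfl
  · exact Nat.one_le_two_pow

lemma isBasic_seqQ (S : Set ℕ) : IsBasic (seqQ S) := fun n => by
  have := lowDigit_add_le S n
  have := numDigits_pos S n
  omega

lemma two_pow_le_seqQ {S : Set ℕ} {n : ℕ} (h : ¬ IsD S n) : 2 ^ n ≤ seqQ S n := by
  rw [seqQ, if_neg h]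
  exact Nat.le_mul_of_pos_right _ (by omega)

lemma tendsto_base : Tendsto base atTop atTop :=
  tendsto_stage.comp ((Nat.tendsto_div_const_atTop (by norm_num)).comp tendsto_cyc)

lemma infiniteInLimit_seqQ (S : Set ℕ) : InfiniteInLimit (seqQ S) := by
  refine tendsto_atTop.mpr fun b => ?_
  filter_upwards [tendsto_base.eventually_ge_atTop b, eventually_ge_atTop b] with n h1 h2
  by_cases hD : IsD S n
  · simpa [seqQ, hD] using h1
  · exact h2.trans ((Nat.lt_two_pow_self).le.trans (two_pow_le_seqQ hD))

end Layout

/-! ### Counting words with prescribed digits -/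

section Counting

lemma sum_ite_mod_eq {b v : ℕ} (hv : v < b) (M : ℕ) :
    ∑ u ∈ Finset.range (M * b), (if u % b = v then 1 else 0) = M := by
  rw [sum_range_mul_eq]
  have h : ∀ t, ∑ e ∈ Finset.range b, (if (t * b + e) % b = v then 1 else 0) = 1 := fun t => by
    rw [Finset.sum_eq_single_of_mem v (Finset.mem_range.mpr hv)]
    · rw [if_pos]; rw [Nat.mul_add_mod', Nat.mod_eq_of_lt hv]
    · intro e he hne
      rw [if_neg]; rw [Nat.mul_add_mod', Nat.mod_eq_of_lt (Finset.mem_range.mp he)]; exact hne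
  rw [Finset.sum_congr rfl fun t _ => h t]
  simp

lemma sum_ite_digits_eq {b : ℕ} (hb : 1 ≤ b) (v : ℕ → ℕ) (d : ℕ) :
    ∀ (P : Finset ℕ) (_ : ∀ p ∈ P, p < d ∧ v p < b) (M : ℕ),
      ∑ i ∈ Finset.range (M * b ^ d), (if ∀ p ∈ P, i / b ^ p % b = v p then 1 else 0) =
        M * b ^ (d - P.card) := by
  induction d with
  | zero =>
    intro P hP M
    have : P = ∅ := Finset.eq_empty_of_forall_notMem fun p hp => by have := (hP p hp).1; omega
    subst this; simp
  | succ d ih =>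
    intro P hP M
    have hP' : ∀ p ∈ P.erase d, p < d ∧ v p < b := fun p hp => by
      have h1 := Finset.ne_of_mem_erase hp
      have h2 := hP p (Finset.mem_of_mem_erase hp)
      exact ⟨by omega, h2.2⟩
    have hcard : (P.erase d).card ≤ d := by
      calc _ ≤ (Finset.range d).card := Finset.card_le_card fun p hp =>
            Finset.mem_range.mpr (hP' p hp).1
        _ = d := Finset.card_range d
    have hstep : ∀ u, ∑ w ∈ Finset.range (b ^ d),
        (if ∀ p ∈ P, (u * b ^ d + w) / b ^ p % b = v p then 1 else 0) =
        (if d ∈ P → u % b = v d then 1 else 0) * b ^ (d - (P.erase d).card) := fun u => by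
      have h := ih (P.erase d) hP' 1
      rw [one_mul, one_mul] at h
      rw [← h, Finset.mul_sum]
      refine Finset.sum_congr rfl fun w hw => ?_
      rw [Finset.mem_range] at hw
      have hlow : ∀ p ∈ P.erase d, (u * b ^ d + w) / b ^ p % b = w / b ^ p % b := fun p hp => by
        obtain ⟨e, rfl⟩ := Nat.exists_eq_add_of_lt (hP' p hp).1
        have hpos : 0 < b ^ p := Nat.pow_pos hb
        rw [show u * b ^ (p + e + 1) + w = w + b ^ p * (u * b ^ e * b) by ring,
          Nat.add_mul_div_left _ _ hpos, Nat.add_mul_mod_self_right]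
      have htop : (u * b ^ d + w) / b ^ d % b = u % b := by
        rw [add_comm, Nat.add_mul_div_right _ _ (Nat.pow_pos hb), Nat.div_eq_of_lt hw, zero_add]
      have hiff : (∀ p ∈ P, (u * b ^ d + w) / b ^ p % b = v p) ↔
          (d ∈ P → u % b = v d) ∧ ∀ p ∈ P.erase d, w / b ^ p % b = v p := by
        constructor
        · intro hall
          exact ⟨fun hd => htop ▸ hall d hd,
            fun p hp => hlow p hp ▸ hall p (Finset.mem_of_mem_erase hp)⟩
        · rintro ⟨h1, h2⟩ p hp
          by_cases hpd : p = d
          · subst hpd; rw [htop]; exact h1 hp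
          · have := Finset.mem_erase.mpr ⟨hpd, hp⟩
            rw [hlow p this]; exact h2 p this
      rw [if_congr hiff rfl rfl, ite_and]
      split_ifs <;> simp
    rw [show M * b ^ (d + 1) = M * b * b ^ d by ring, sum_range_mul_eq]
    simp_rw [hstep]
    rw [← Finset.sum_mul]
    by_cases hd : d ∈ P
    · have h1 : ∀ u, (if d ∈ P → u % b = v d then 1 else 0) = if u % b = v d then 1 else 0 :=
        fun u => by simp [hd]
      simp_rw [h1]
      rw [sum_ite_mod_eq (hP d hd).2, Finset.card_erase_of_mem hd]
      have : 1 ≤ P.card := Finset.card_pos.mpr ⟨d, hd⟩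
      congr 2; omega
    · simp only [hd, false_imp_iff, if_true, Finset.sum_const, Finset.card_range]
      rw [Finset.erase_eq_of_notMem hd] at hcard ⊢
      rw [show d + 1 - P.card = d - P.card + 1 by omega, pow_succ]
      simp; ring

lemma sum_ite_word_eq {b k M N : ℕ} (hb : 1 ≤ b) {pos : Fin k → ℕ} (hpos : Function.Injective pos)
    (hlt : ∀ j, pos j < b) {B : Fin k → ℕ} (hB : ∀ j, B j < b) (hN : M * b ^ b ≤ N) :
    ∑ i ∈ Finset.range N,
      (if i < M * b ^ b ∧ ∀ j, i / b ^ pos j % b = B j then 1 else 0) = M * b ^ (b - k) := by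
  have h := sum_ite_digits_eq hb (Function.extend pos B 0) b (Finset.univ.image pos)
    (fun p hp => by
      obtain ⟨j, -, rfl⟩ := Finset.mem_image.mp hp
      exact ⟨hlt j, by rw [hpos.extend_apply]; exact hB j⟩) M
  rw [Finset.card_image_of_injective _ hpos, Finset.card_univ, Fintype.card_fin] at h
  rw [← h]
  simp_rw [ite_and]
  rw [← Finset.sum_filter]
  have hfil : (Finset.range N).filter (· < M * b ^ b) = Finset.range (M * b ^ b) := by
    ext i; simp only [Finset.mem_filter, Finset.mem_range]; omega
  rw [hfil]
  refine Finset.sum_congr rfl fun i _ => if_congr ?_ rfl rfl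
  simp [hpos.extend_apply]

end Counting

/-! ### Block sums of the construction -/

section BlockSums

/-- The leading part of a block sum. -/
noncomputable def mainSum (κ : ℕ → ℕ) (O : ℕ → Prop) (p k b : ℕ) : ℕ :=
  ∑ o ∈ Finset.range b,
    if O o ∧ o + p < b then κ o * (b ^ (4 * (b - (o + p))) * b ^ (b - k)) else 0

/-- `E` is an admissible digit sequence of the construction. -/
def Admissible (S : Set ℕ) (E : ℕ → ℕ) : Prop :=
  ∀ n, lowDigit S n ≤ E n ∧ E n < lowDigit S n + numDigits S n

lemma Admissible.eq_of_isA {S : Set ℕ} {E : ℕ → ℕ} (hE : Admissible S E) {n : ℕ} (h : IsA n) :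
    E n = slot n / base n ^ (off n - 1) % base n := by
  have hD : ¬ IsD S n := fun h' => not_isA_of_isD h' h
  have := hE n
  simp only [lowDigit, numDigits, hD, h, if_true, if_false, or_true] at this
  omega

lemma Admissible.le_of_not_isA {S : Set ℕ} {E : ℕ → ℕ} (hE : Admissible S E) {n : ℕ}
    (h : ¬ IsA n) : base n - 2 ≤ E n ∨ 2 ^ n ≤ E n := by
  have := (hE n).1
  by_cases hD : IsD S n
  · left; simpa [lowDigit, hD] using this
  · right
    simp only [lowDigit, hD, h, if_false] at this
    exact (Nat.le_mul_of_pos_right _ (by omega)).trans this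

lemma wordCount_anti {b o o' : ℕ} (hb : 1 ≤ b) (h : o ≤ o') : wordCount b o' ≤ wordCount b o :=
  Nat.mul_le_mul_left _ (Nat.pow_le_pow_right hb (by omega))

lemma wordCount_le {b c : ℕ} (hb : 1 ≤ b) (hc : b ^ (5 * b + 4) ≤ c) (o : ℕ) :
    2 * wordCount b o ≤ 2 * c := by
  rw [wordCount, ← pow_add]
  exact Nat.mul_le_mul_left _ ((Nat.pow_le_pow_right hb (by omega)).trans hc)

lemma lt_of_pow_le {b c : ℕ} (hb : 2 ≤ b) (hc : b ^ (5 * b + 4) ≤ c) : b < c :=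
  (Nat.lt_pow_self (by omega : 1 < b)).trans_le
    ((Nat.pow_le_pow_right (by omega) (by omega)).trans hc)

lemma isA_layout_iff {c i o : ℕ} (hi : i < 2 * c) (ho : o < (2 * c).factorial) :
    IsA ((i + 1) * (2 * c).factorial + o) ↔
      1 ≤ o ∧ o ≤ stage c ∧ i < wordCount (stage c) (o - 1) := by
  obtain ⟨h1, h2, h3⟩ := layout hi ho
  have h4 : base ((i + 1) * (2 * c).factorial + o) = stage c := by
    rw [base, h1]; congr 1; omega
  rw [IsA, h1, h2, h3, h4]
  simp

lemma isD_layout_iff {S : Set ℕ} {c i o : ℕ} (hi : i < 2 * c + 1)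
    (ho : o < (2 * c + 1).factorial) :
    IsD S ((i + 1) * (2 * c + 1).factorial + o) ↔
      o < stage c ∧ i < kap S (o + 1) * wordCount (stage c) o := by
  obtain ⟨h1, h2, h3⟩ := layout hi ho
  have h4 : base ((i + 1) * (2 * c + 1).factorial + o) = stage c := by
    rw [base, h1]; congr 1; omega
  rw [IsD, h1, h2, h3, h4]
  have : (2 * c + 1) % 2 = 1 := by omega
  simp [this]

lemma matches_iff {S : Set ℕ} {E : ℕ → ℕ} (hE : Admissible S E) {k gap c : ℕ} (hk : 1 ≤ k)
    {B : Fin k → ℕ} (hc : stage c ^ (5 * stage c + 4) ≤ c)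
    (hB : ∀ j, B j + 2 < stage c) (hkg : k * gap < c) {i o : ℕ} (hi : i < 2 * c)
    (ho : o < (2 * c).factorial) :
    (∀ j : Fin k, E ((i + 1) * (2 * c).factorial + o + j * gap) = B j) ↔
      1 ≤ o ∧ o - 1 + (k - 1) * gap < stage c ∧
        i < wordCount (stage c) (o - 1 + (k - 1) * gap) ∧
        ∀ j : Fin k, i / stage c ^ (o - 1 + j * gap) % stage c = B j := by
  have hb := two_le_stage c
  have hbc := lt_of_pow_le hb hc
  have hfac : 2 * c ≤ (2 * c).factorial := Nat.self_le_factorial _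
  have hpos := Nat.factorial_pos (2 * c)
  have hj : ∀ j : Fin k, (j : ℕ) * gap ≤ (k - 1) * gap := fun j =>
    Nat.mul_le_mul_right _ (by have := j.2; omega)
  have hk' : (k - 1) * gap ≤ k * gap := Nat.mul_le_mul_right _ (by omega)
  have hbig : ∀ {o' v : ℕ}, o' < (2 * c).factorial → v + 2 < stage c →
      E ((i + 1) * (2 * c).factorial + o') = v →
        (1 ≤ o' ∧ o' ≤ stage c ∧ i < wordCount (stage c) (o' - 1)) ∧
          i / stage c ^ (o' - 1) % stage c = v := fun {o' v} ho' hv hEv => by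
    obtain ⟨h1, h2, h3⟩ := layout hi ho'
    have h4 : base ((i + 1) * (2 * c).factorial + o') = stage c := by
      rw [base, h1]; congr 1; omega
    have hA : IsA ((i + 1) * (2 * c).factorial + o') := by
      by_contra hA
      rcases hE.le_of_not_isA hA with h | h
      · rw [h4, hEv] at h; omega
      · have h5 := Nat.lt_two_pow_self (n := (i + 1) * (2 * c).factorial + o')
        have h6 : (2 * c).factorial ≤ (i + 1) * (2 * c).factorial :=
          Nat.le_mul_of_pos_left _ (by omega)
        omega
    refine ⟨(isA_layout_iff hi ho').mp hA, ?_⟩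
    rw [← hEv, hE.eq_of_isA hA, h2, h3, h4]
  constructor
  · intro hall
    have h0 := (hbig ho (hB ⟨0, hk⟩) (by simpa using hall ⟨0, hk⟩)).1
    have hjo : ∀ j : Fin k, o + j * gap < (2 * c).factorial := fun j => by have := hj j; omega
    have hlast := (hbig (hjo ⟨k - 1, by omega⟩) (hB _) (by
      simpa [add_assoc] using hall ⟨k - 1, by omega⟩)).1
    simp only at hlast
    have e1 : o + (k - 1) * gap - 1 = o - 1 + (k - 1) * gap := by omega
    rw [e1] at hlast
    refine ⟨h0.1, by omega, hlast.2.2, fun j => ?_⟩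
    have := (hbig (hjo j) (hB j) (by rw [← add_assoc]; exact hall j)).2
    rwa [show o + (j : ℕ) * gap - 1 = o - 1 + j * gap by omega] at this
  · rintro ⟨h1, h2, h3, h4⟩ j
    have hjo : o + j * gap < (2 * c).factorial := by have := hj j; omega
    obtain ⟨g1, g2, g3⟩ := layout hi hjo
    have g4 : base ((i + 1) * (2 * c).factorial + (o + j * gap)) = stage c := by
      rw [base, g1]; congr 1; omega
    have e1 : o + (j : ℕ) * gap - 1 = o - 1 + j * gap := by omega
    have hA := (isA_layout_iff hi hjo).mpr ⟨by omega, by have := hj j; omega, by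
      rw [e1]; exact h3.trans_le (wordCount_anti (by omega) (by have := hj j; omega))⟩
    rw [add_assoc, hE.eq_of_isA hA, g2, g3, g4, e1]
    exact h4 j

lemma mod_layout {m P : ℕ} (h : m ∣ P) (a o : ℕ) : (a * P + o) % m = o % m := by
  obtain ⟨d, rfl⟩ := h
  rw [show a * (m * d) + o = o + m * (a * d) by ring, Nat.add_mul_mod_self_left]

lemma sum_matches_even {S : Set ℕ} {E : ℕ → ℕ} (hE : Admissible S E) {k gap m r c : ℕ}
    (hk : 1 ≤ k) (hgap : 1 ≤ gap) (hm : 1 ≤ m) {B : Fin k → ℕ}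
    (hc : stage c ^ (5 * stage c + 4) ≤ c)
    (hB : ∀ j, B j + 2 < stage c) (hkg : k * gap < c) (hmc : m ≤ c) :
    ∑ n ∈ Finset.Ico (2 * c).factorial (2 * c + 1).factorial,
        (if n % m = r ∧ ∀ j : Fin k, E (n + j * gap) = B j then 1 else 0) =
      mainSum (fun _ => 1) (fun o => (o + 1) % m = r) ((k - 1) * gap) k (stage c) := by
  have hb := two_le_stage c
  have hbc := lt_of_pow_le hb hc
  have hfac : 2 * c ≤ (2 * c).factorial := Nat.self_le_factorial _
  have hmdvd : m ∣ (2 * c).factorial := Nat.dvd_factorial (by omega) (by omega)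
  set b := stage c with hbdef
  set p := (k - 1) * gap with hp
  rw [sum_cycle]
  have hinner : ∀ o ∈ Finset.range (2 * c).factorial,
      ∑ i ∈ Finset.range (2 * c), (if ((i + 1) * (2 * c).factorial + o) % m = r ∧
        ∀ j : Fin k, E ((i + 1) * (2 * c).factorial + o + j * gap) = B j then 1 else 0) =
      if 1 ≤ o ∧ o % m = r ∧ o - 1 + p < b then b ^ (4 * (b - (o - 1 + p))) * b ^ (b - k)
        else 0 := fun o ho => by
    rw [Finset.mem_range] at ho
    have hcongr : ∀ i ∈ Finset.range (2 * c),
        (if ((i + 1) * (2 * c).factorial + o) % m = r ∧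
          ∀ j : Fin k, E ((i + 1) * (2 * c).factorial + o + j * gap) = B j then 1 else 0) =
        if 1 ≤ o ∧ o % m = r ∧ o - 1 + p < b then
          (if i < b ^ (4 * (b - (o - 1 + p))) * b ^ b ∧
            ∀ j : Fin k, i / b ^ (o - 1 + j * gap) % b = B j then 1 else 0) else 0 := fun i hi => by
      rw [Finset.mem_range] at hi
      rw [mod_layout hmdvd, ← ite_and]
      refine if_congr ?_ rfl rfl
      rw [matches_iff hE hk hc hB hkg hi ho, wordCount, mul_comm (b ^ _)]
      tauto
    rw [Finset.sum_congr rfl hcongr]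
    split_ifs with hcond
    · refine sum_ite_word_eq (by omega) ?_ ?_ (fun j => by have := hB j; omega) ?_
      · intro j j' hjj
        simp only at hjj
        have : (j : ℕ) * gap = j' * gap := by omega
        exact Fin.ext (Nat.eq_of_mul_eq_mul_right (by omega) this)
      · intro j
        have : (j : ℕ) * gap ≤ p := Nat.mul_le_mul_right _ (by have := j.2; omega)
        omega
      · rw [mul_comm]
        have := wordCount_le (by omega : 1 ≤ b) hc (o - 1 + p)
        exact (by rw [wordCount] at this; omega)
    · simp
  rw [Finset.sum_congr rfl hinner]
  obtain ⟨D, hD⟩ : ∃ D, (2 * c).factorial = D + 1 := ⟨(2 * c).factorial - 1, by omega⟩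
  rw [hD, Finset.sum_range_succ', mainSum]
  simp only [nonpos_iff_eq_zero, one_ne_zero, false_and, if_false, add_zero, Nat.add_sub_cancel,
    one_mul]
  have hsub : Finset.range b ⊆ Finset.range D := Finset.range_mono (by omega)
  rw [← Finset.sum_subset hsub]
  · exact Finset.sum_congr rfl fun o _ => if_congr (by simp) rfl rfl
  · intro o _ ho
    rw [Finset.mem_range] at ho
    rw [if_neg]; omega

lemma kap_le_two (S : Set ℕ) (l : ℕ) : kap S l ≤ 2 := by unfold kap; split_ifs <;> omega

lemma one_le_kap (S : Set ℕ) (l : ℕ) : 1 ≤ kap S l := by unfold kap; split_ifs <;> omega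

lemma inv_prod_seqQ_le {S : Set ℕ} {n k : ℕ} (h : ∃ j < k, ¬ IsD S (n + j)) :
    (∏ i ∈ Finset.range k, (seqQ S (n + i) : ℝ))⁻¹ ≤ (1 / 2) ^ n := by
  obtain ⟨j, hj, hjD⟩ := h
  have h1 : ∀ i, (1 : ℝ) ≤ seqQ S (n + i) := fun i => by
    exact_mod_cast (by have := isBasic_seqQ S (n + i); omega : 1 ≤ seqQ S (n + i))
  have h2 : (2 : ℝ) ^ n ≤ ∏ i ∈ Finset.range k, (seqQ S (n + i) : ℝ) := by
    calc (2 : ℝ) ^ n ≤ 2 ^ (n + j) := pow_le_pow_right₀ (by norm_num) (by omega)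
      _ ≤ seqQ S (n + j) := by exact_mod_cast two_pow_le_seqQ hjD
      _ = ∏ i ∈ Finset.range k, if i = j then (seqQ S (n + i) : ℝ) else 1 := by
          rw [Finset.prod_ite_eq']; simp [hj]
      _ ≤ _ := by
          refine Finset.prod_le_prod (fun i _ => ?_) fun i _ => ?_
          · split_ifs
            · exact Nat.cast_nonneg _
            · exact zero_le_one
          · split_ifs
            · exact le_rfl
            · exact h1 i
  rw [one_div, inv_pow]
  exact inv_anti₀ (by positivity) h2

lemma inv_prod_seqQ_nonneg (S : Set ℕ) (n k : ℕ) :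
    0 ≤ (∏ i ∈ Finset.range k, (seqQ S (n + i) : ℝ))⁻¹ :=
  inv_nonneg.mpr (Finset.prod_nonneg fun _ _ => Nat.cast_nonneg _)

lemma kap_mul_wordCount_anti {S : Set ℕ} {b o o' : ℕ} (hb : 2 ≤ b) (h : o ≤ o') (ho' : o' < b) :
    kap S (o' + 1) * wordCount b o' ≤ kap S (o + 1) * wordCount b o := by
  rcases h.eq_or_lt with rfl | h
  · exact le_rfl
  have h1 : wordCount b o' * 2 ≤ wordCount b o := by
    calc wordCount b o' * 2 ≤ wordCount b o' * b := Nat.mul_le_mul_left _ hb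
      _ = b ^ b * b ^ (4 * (b - o') + 1) := by rw [wordCount, pow_succ]; ring
      _ ≤ _ := Nat.mul_le_mul_left _ (Nat.pow_le_pow_right (by omega) (by omega))
  calc kap S (o' + 1) * wordCount b o' ≤ 2 * wordCount b o' :=
        Nat.mul_le_mul_right _ (kap_le_two S _)
    _ ≤ 1 * wordCount b o := by omega
    _ ≤ _ := Nat.mul_le_mul_right _ (one_le_kap S _)

lemma all_isD_iff {S : Set ℕ} {k c : ℕ} (hk : 1 ≤ k) (hc : stage c ^ (5 * stage c + 4) ≤ c)
    (hkc : k < c) {i o : ℕ} (hi : i < 2 * c + 1) (ho : o < (2 * c + 1).factorial) :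
    (∀ j < k, IsD S ((i + 1) * (2 * c + 1).factorial + o + j)) ↔
      o + (k - 1) < stage c ∧ i < kap S (o + k) * wordCount (stage c) (o + (k - 1)) := by
  have hb := two_le_stage c
  have hbc := lt_of_pow_le hb hc
  have hfac : 2 * c + 1 ≤ (2 * c + 1).factorial := Nat.self_le_factorial _
  have e : o + (k - 1) + 1 = o + k := by omega
  constructor
  · intro h
    have h0 := (isD_layout_iff hi ho).mp (by simpa using h 0 hk)
    have h1 := (isD_layout_iff (o := o + (k - 1)) hi (by omega)).mp
      (by rw [← add_assoc]; exact h (k - 1) (by omega))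
    rwa [e] at h1
  · rintro ⟨h1, h2⟩ j hj
    rw [add_assoc, isD_layout_iff hi (by omega)]
    refine ⟨by omega, h2.trans_le ?_⟩
    rw [← e]
    exact kap_mul_wordCount_anti hb (by omega) h1

lemma inv_prod_layout {S : Set ℕ} {k c : ℕ} (hk : 1 ≤ k)
    (hc : stage c ^ (5 * stage c + 4) ≤ c) (hkc : k < c) {i o : ℕ} (hi : i < 2 * c + 1)
    (ho : o < (2 * c + 1).factorial) {n : ℕ} (hn : n = (i + 1) * (2 * c + 1).factorial + o)
    {v : ℝ} (hv : v = if o + (k - 1) < stage c ∧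
      i < kap S (o + k) * wordCount (stage c) (o + (k - 1)) then ((stage c : ℝ) ^ k)⁻¹ else 0) :
    v ≤ (∏ i ∈ Finset.range k, (seqQ S (n + i) : ℝ))⁻¹ ∧
      (∏ i ∈ Finset.range k, (seqQ S (n + i) : ℝ))⁻¹ ≤ v + (1 / 2) ^ n := by
  subst hn
  have hiff := all_isD_iff (S := S) hk hc hkc hi ho
  by_cases h : o + (k - 1) < stage c ∧ i < kap S (o + k) * wordCount (stage c) (o + (k - 1))
  · rw [if_pos h] at hv
    have hall := hiff.mpr h
    have heq : ∏ j ∈ Finset.range k, (seqQ S ((i + 1) * (2 * c + 1).factorial + o + j) : ℝ) =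
        (stage c : ℝ) ^ k := by
      rw [Finset.prod_congr rfl (g := fun _ => (stage c : ℝ)), Finset.prod_const,
        Finset.card_range]
      intro j hj
      rw [Finset.mem_range] at hj
      have hb := lt_of_pow_le (two_le_stage c) hc
      have hfac : 2 * c + 1 ≤ (2 * c + 1).factorial := Nat.self_le_factorial _
      have h1 := (layout hi (by omega : o + j < (2 * c + 1).factorial)).1
      rw [seqQ, if_pos (hall j hj), add_assoc, base, h1]
      congr 2; omega
    rw [heq, hv]
    exact ⟨le_rfl, le_add_of_nonneg_right (by positivity)⟩
  · rw [if_neg h] at hv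
    rw [hv, zero_add]
    refine ⟨inv_prod_seqQ_nonneg _ _ _, inv_prod_seqQ_le ?_⟩
    by_contra hcon
    push Not at hcon
    exact h (hiff.mp hcon)

lemma sum_weight_odd {S : Set ℕ} {k m r c : ℕ} (hk : 1 ≤ k) (hm : 1 ≤ m)
    (hc : stage c ^ (5 * stage c + 4) ≤ c) (hkc : k < c) (hmc : m ≤ c) {s e : ℝ}
    (hs : s = ∑ n ∈ Finset.Ico (2 * c + 1).factorial (2 * c + 1 + 1).factorial,
      if n % m = r then (∏ i ∈ Finset.range k, (seqQ S (n + i) : ℝ))⁻¹ else 0)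
    (he : e = ∑ n ∈ Finset.Ico (2 * c + 1).factorial (2 * c + 1 + 1).factorial, (1 / 2 : ℝ) ^ n) :
    (mainSum (fun o => kap S (o + k)) (fun o => o % m = r) (k - 1) k (stage c) : ℝ) ≤ s ∧
      s ≤ mainSum (fun o => kap S (o + k)) (fun o => o % m = r) (k - 1) k (stage c) + e := by
  have hb := two_le_stage c
  have hbc := lt_of_pow_le hb hc
  have hfac : 2 * c + 1 ≤ (2 * c + 1).factorial := Nat.self_le_factorial _
  have hmdvd : m ∣ (2 * c + 1).factorial := Nat.dvd_factorial (by omega) (by omega)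
  have hbR : (0 : ℝ) < stage c := by exact_mod_cast (by omega : 0 < stage c)
  have hmain : (mainSum (fun o => kap S (o + k)) (fun o => o % m = r) (k - 1) k (stage c) : ℝ) =
      ∑ o ∈ Finset.range (2 * c + 1).factorial, ∑ i ∈ Finset.range (2 * c + 1),
        if o % m = r then (if o + (k - 1) < stage c ∧
          i < kap S (o + k) * wordCount (stage c) (o + (k - 1)) then ((stage c : ℝ) ^ k)⁻¹ else 0)
        else 0 := by
    rw [mainSum]
    have hsub : Finset.range (stage c) ⊆ Finset.range (2 * c + 1).factorial :=
      Finset.range_mono (by omega)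
    push_cast
    refine Finset.sum_subset_zero_on_sdiff hsub ?_ ?_
    · intro o ho
      rw [Finset.mem_sdiff, Finset.mem_range, Finset.mem_range] at ho
      have : ¬ (o + (k - 1) < stage c) := by omega
      simp [this]
    · intro o ho
      by_cases h1 : o % m = r
      · by_cases h2 : o + (k - 1) < stage c
        · simp only [h1, h2, true_and, and_self, if_true]
          rw [← Finset.sum_filter, Finset.sum_const, nsmul_eq_mul]
          have hle : kap S (o + k) * wordCount (stage c) (o + (k - 1)) ≤ 2 * c :=
            (Nat.mul_le_mul_right _ (kap_le_two S _)).trans (wordCount_le (by omega) hc _)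
          have hfil : (Finset.range (2 * c + 1)).filter
              (· < kap S (o + k) * wordCount (stage c) (o + (k - 1))) =
              Finset.range (kap S (o + k) * wordCount (stage c) (o + (k - 1))) := by
            ext i; simp only [Finset.mem_filter, Finset.mem_range]; omega
          rw [hfil, Finset.card_range, wordCount]
          have : (stage c : ℝ) ^ (stage c) = stage c ^ (stage c - k) * stage c ^ k := by
            rw [← pow_add]; congr 1; omega
          push_cast
          rw [this]
          field_simp
        · simp [h2]
      · simp [h1]
  rw [hmain, hs, he, sum_cycle, sum_cycle, ← Finset.sum_add_distrib]
  simp_rw [← Finset.sum_add_distrib]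
  have key : ∀ o ∈ Finset.range (2 * c + 1).factorial, ∀ i ∈ Finset.range (2 * c + 1), _ :=
    fun o ho i hi => inv_prod_layout (S := S) hk hc hkc (Finset.mem_range.mp hi)
      (Finset.mem_range.mp ho) rfl rfl
  constructor
  · refine Finset.sum_le_sum fun o ho => Finset.sum_le_sum fun i hi => ?_
    rw [mod_layout hmdvd]
    split_ifs with h1 h2
    · simpa only [if_pos h2] using (key o ho i hi).1
    · exact inv_prod_seqQ_nonneg _ _ _
    · exact le_rfl
  · refine Finset.sum_le_sum fun o ho => Finset.sum_le_sum fun i hi => ?_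
    rw [mod_layout hmdvd]
    split_ifs with h1 h2
    · simpa only [if_pos h2] using (key o ho i hi).2
    · simpa only [if_neg h2] using (key o ho i hi).2
    · positivity

lemma sum_weight_even {S : Set ℕ} {k m r c : ℕ} (hk : 1 ≤ k) :
    ∑ n ∈ Finset.Ico (2 * c).factorial (2 * c + 1).factorial,
        (if n % m = r then (∏ i ∈ Finset.range k, (seqQ S (n + i) : ℝ))⁻¹ else 0) ≤
      ∑ n ∈ Finset.Ico (2 * c).factorial (2 * c + 1).factorial, (1 / 2 : ℝ) ^ n := by
  refine Finset.sum_le_sum fun n hn => ?_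
  rw [Finset.mem_Ico] at hn
  split_ifs
  · refine inv_prod_seqQ_le ⟨0, hk, fun hD => ?_⟩
    have := hD.1
    rw [add_zero, cyc_eq hn.1 hn.2] at this
    omega
  · positivity

lemma sum_matches_odd {S : Set ℕ} {E : ℕ → ℕ} (hE : Admissible S E) {k gap m r c : ℕ}
    (hk : 1 ≤ k) {B : Fin k → ℕ} (hc : stage c ^ (5 * stage c + 4) ≤ c)
    (hB : ∀ j, B j + 2 < stage c) :
    ∑ n ∈ Finset.Ico (2 * c + 1).factorial (2 * c + 1 + 1).factorial,
        (if n % m = r ∧ ∀ j : Fin k, E (n + j * gap) = B j then 1 else 0) = 0 := by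
  have hbc := lt_of_pow_le (two_le_stage c) hc
  refine Finset.sum_eq_zero fun n hn => if_neg ?_
  rw [Finset.mem_Ico] at hn
  rintro ⟨-, h⟩
  have h0 : E n = B ⟨0, hk⟩ := by simpa using h ⟨0, hk⟩
  have hcyc := cyc_eq hn.1 hn.2
  have hB0 := hB ⟨0, hk⟩
  have hfac : 2 * c + 1 ≤ (2 * c + 1).factorial := Nat.self_le_factorial _
  rcases hE.le_of_not_isA (n := n) (fun hA => by have := hA.1; rw [hcyc] at this; omega)
    with h1 | h1
  · rw [base, hcyc, show (2 * c + 1) / 2 = c by omega] at h1; omega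
  · have := Nat.lt_two_pow_self (n := n); omega

lemma sum_Ico_half_pow_le (a b : ℕ) : ∑ n ∈ Finset.Ico a b, (1 / 2 : ℝ) ^ n ≤ 2 * (1 / 2) ^ a := by
  have h := geom_sum_Ico_le_of_lt_one (x := (1 / 2 : ℝ)) (m := a) (n := b) (by norm_num)
    (by norm_num)
  refine h.trans (le_of_eq ?_)
  norm_num; ring

end BlockSums

/-! ### Leading order of the block sums -/

section Leading

/-- The order of magnitude of the contribution of offset `o` to a block sum. -/
noncomputable def magnitude (p k o b : ℕ) : ℕ := b ^ (4 * (b - (o + p))) * b ^ (b - k)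

lemma mainSum_le {κ : ℕ → ℕ} (hκ : ∀ o, κ o ≤ 2) {O : ℕ → Prop} {o₀ : ℕ}
    (hmin : ∀ o, O o → o₀ ≤ o) (p k b : ℕ) (hb : 1 ≤ b) :
    mainSum κ O p k b * b ^ 3 ≤ κ o₀ * magnitude p k o₀ b * b ^ 3 + 2 * magnitude p k o₀ b := by
  have hterm : ∀ o ∈ Finset.range b, (if O o ∧ o + p < b then
      κ o * (b ^ (4 * (b - (o + p))) * b ^ (b - k)) else 0) * b ^ 4 ≤
      (if o = o₀ then κ o₀ * magnitude p k o₀ b * b ^ 4 else 0) + 2 * magnitude p k o₀ b := by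
    intro o _
    by_cases h : O o ∧ o + p < b
    · rw [if_pos h]
      by_cases ho : o = o₀
      · subst ho; rw [if_pos rfl]; simp only [magnitude]; omega
      · rw [if_neg ho, zero_add]
        have h1 : o₀ < o := lt_of_le_of_ne (hmin o h.1) (Ne.symm ho)
        calc κ o * (b ^ (4 * (b - (o + p))) * b ^ (b - k)) * b ^ 4
            = κ o * (b ^ (4 * (b - (o + p)) + 4) * b ^ (b - k)) := by rw [pow_add]; ring
          _ ≤ 2 * (b ^ (4 * (b - (o₀ + p))) * b ^ (b - k)) := by
              refine Nat.mul_le_mul (hκ o) (Nat.mul_le_mul_right _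
                (Nat.pow_le_pow_right hb (by omega)))
          _ = _ := rfl
    · rw [if_neg h]; simp
  have hsum := Finset.sum_le_sum hterm
  rw [← Finset.sum_mul, Finset.sum_add_distrib, Finset.sum_const, Finset.card_range,
    Finset.sum_ite_eq'] at hsum
  change mainSum κ O p k b * b ^ 4 ≤ _ at hsum
  have h2 : mainSum κ O p k b * b ^ 3 * b ≤
      (κ o₀ * magnitude p k o₀ b * b ^ 3 + 2 * magnitude p k o₀ b) * b := by
    calc _ = mainSum κ O p k b * b ^ 4 := by ring
      _ ≤ _ := hsum
      _ ≤ κ o₀ * magnitude p k o₀ b * b ^ 4 + b * (2 * magnitude p k o₀ b) := by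
          rw [smul_eq_mul]; gcongr; split_ifs <;> simp
      _ = _ := by ring
  exact Nat.le_of_mul_le_mul_right h2 hb

lemma le_mainSum {κ : ℕ → ℕ} {O : ℕ → Prop} {o₀ p : ℕ} (hO : O o₀) (k : ℕ) {b : ℕ}
    (hb : o₀ + p < b) : κ o₀ * magnitude p k o₀ b ≤ mainSum κ O p k b := by
  have h := Finset.single_le_sum (f := fun o => if O o ∧ o + p < b then
      κ o * (b ^ (4 * (b - (o + p))) * b ^ (b - k)) else 0) (fun o _ => Nat.zero_le _)
      (Finset.mem_range.mpr (by omega : o₀ < b))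
  simp only [hO, hb, and_self, if_true] at h
  exact h

lemma magnitude_pos (p k o : ℕ) {b : ℕ} (hb : 1 ≤ b) : 1 ≤ magnitude p k o b :=
  Nat.succ_le_of_lt (Nat.mul_pos (Nat.pow_pos hb) (Nat.pow_pos hb))

lemma magnitude_le (p k o : ℕ) {b : ℕ} (hb : 1 ≤ b) : magnitude p k o b ≤ b ^ (5 * b) := by
  rw [magnitude, ← pow_add]; exact Nat.pow_le_pow_right hb (by omega)

lemma tendsto_mainSum {κ : ℕ → ℕ} (hκ : ∀ o, κ o ≤ 2) {O : ℕ → Prop} {o₀ : ℕ} (hO : O o₀)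
    (hmin : ∀ o, O o → o₀ ≤ o) (p k : ℕ) :
    Tendsto (fun b => (mainSum κ O p k b : ℝ) / magnitude p k o₀ b) atTop (𝓝 (κ o₀)) := by
  have h0 : Tendsto (fun b : ℕ => (κ o₀ : ℝ) + 2 / b) atTop (𝓝 (κ o₀)) := by
    simpa using (tendsto_const_div_atTop_nhds_zero_nat (2 : ℝ)).const_add (κ o₀ : ℝ)
  refine tendsto_of_tendsto_of_tendsto_of_le_of_le' tendsto_const_nhds h0 ?_ ?_
  · filter_upwards [eventually_gt_atTop (o₀ + p)] with b hb
    have hm : (0 : ℝ) < magnitude p k o₀ b := by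
      exact_mod_cast magnitude_pos p k o₀ (by omega : 1 ≤ b)
    rw [le_div_iff₀ hm]
    exact_mod_cast le_mainSum hO k hb
  · filter_upwards [eventually_ge_atTop 1] with b hb
    have hm : (0 : ℝ) < magnitude p k o₀ b := by exact_mod_cast magnitude_pos p k o₀ hb
    have hbR : (1 : ℝ) ≤ b := by exact_mod_cast hb
    have h1 : (mainSum κ O p k b : ℝ) * b ^ 3 ≤
        κ o₀ * magnitude p k o₀ b * b ^ 3 + 2 * magnitude p k o₀ b := by
      exact_mod_cast mainSum_le hκ hmin p k b hb
    have h3 : (b : ℝ) ≤ b ^ 3 := by nlinarith [sq_nonneg ((b : ℝ) - 1)]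
    rw [div_le_iff₀ hm]
    have h4 : (2 : ℝ) * magnitude p k o₀ b / b ^ 3 ≤ 2 * magnitude p k o₀ b / b :=
      div_le_div_of_nonneg_left (by positivity) (by positivity) h3
    have h5 : (mainSum κ O p k b : ℝ) ≤
        κ o₀ * magnitude p k o₀ b + 2 * magnitude p k o₀ b / b ^ 3 := by
      have hb3 : (0 : ℝ) < (b : ℝ) ^ 3 := by positivity
      rw [← mul_le_mul_iff_left₀ hb3, add_mul, div_mul_cancel₀ _ hb3.ne']
      exact h1
    calc _ ≤ _ := h5
      _ ≤ _ := add_le_add_right h4 _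
      _ = _ := by ring

/-- Endpoints of the blocks, each consisting of an even and an odd cycle. -/
def blockStart (c : ℕ) : ℕ := (2 * c).factorial

lemma blockStart_strictMono : StrictMono blockStart := by
  refine strictMono_nat_of_lt_succ fun c => ?_
  rcases Nat.eq_zero_or_pos c with rfl | h
  · simp [blockStart]
  · exact (Nat.factorial_lt (by omega)).mpr (by omega)

/-- The sum of `g` over a block. -/
noncomputable def blockSum (g : ℕ → ℝ) (c : ℕ) : ℝ :=
  ∑ n ∈ Finset.Ico (blockStart c) (blockStart (c + 1)), g n

/-- The block sums of `g ≥ 0` are asymptotic to `l` times the given magnitude. -/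
structure Leads (g : ℕ → ℝ) (p k o : ℕ) (l : ℝ) : Prop where
  nonneg : ∀ n, 0 ≤ g n
  one_le : 1 ≤ l
  tendsto : Tendsto (fun c => blockSum g c / magnitude p k o (stage c)) atTop (𝓝 l)

lemma magnitude_stage_pos (p k o c : ℕ) : (0 : ℝ) < magnitude p k o (stage c) := by
  exact_mod_cast magnitude_pos p k o (by have := two_le_stage c; omega : 1 ≤ stage c)

lemma leads_of_mainSum {g : ℕ → ℝ} (hg : ∀ n, 0 ≤ g n) {κ : ℕ → ℕ} (hκ : ∀ o, κ o ≤ 2)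
    {O : ℕ → Prop} {o₀ : ℕ} (hκ1 : 1 ≤ κ o₀) (hO : O o₀) (hmin : ∀ o, O o → o₀ ≤ o) {p k : ℕ}
    (hlow : ∀ᶠ c in atTop, (mainSum κ O p k (stage c) : ℝ) ≤ blockSum g c)
    (hup : ∀ᶠ c in atTop, blockSum g c ≤ mainSum κ O p k (stage c) + 2 * (1 / 2) ^ c) :
    Leads g p k o₀ (κ o₀) := by
  refine ⟨hg, by exact_mod_cast hκ1, ?_⟩
  have h1 := (tendsto_mainSum hκ hO hmin p k).comp tendsto_stage
  have h2 : Tendsto (fun c : ℕ => 2 * (1 / 2 : ℝ) ^ c) atTop (𝓝 0) := by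
    simpa using (tendsto_pow_atTop_nhds_zero_of_lt_one (by norm_num : (0 : ℝ) ≤ 1 / 2)
      (by norm_num)).const_mul 2
  have h3 := h1.add h2
  rw [add_zero] at h3
  refine tendsto_of_tendsto_of_tendsto_of_le_of_le' h1 h3 ?_ ?_
  · filter_upwards [hlow] with c hc
    exact div_le_div_of_nonneg_right hc (magnitude_stage_pos _ _ _ _).le
  · filter_upwards [hup] with c hc
    have hm : (1 : ℝ) ≤ magnitude p k o₀ (stage c) := by
      exact_mod_cast magnitude_pos p k o₀ (by have := two_le_stage c; omega : 1 ≤ stage c)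
    rw [div_le_iff₀ (by linarith)]
    simp only [Function.comp]
    rw [add_mul, div_mul_cancel₀ _ (by linarith)]
    have : (2 : ℝ) * (1 / 2) ^ c ≤ 2 * (1 / 2) ^ c * magnitude p k o₀ (stage c) :=
      le_mul_of_one_le_right (by positivity) hm
    linarith

lemma Leads.half_le {g : ℕ → ℝ} {p k o : ℕ} {l : ℝ} (h : Leads g p k o l) :
    ∀ᶠ c in atTop, 1 / 2 ≤ blockSum g c := by
  filter_upwards [h.tendsto.eventually_const_lt (by linarith [h.one_le] : 1 / 2 < l)] with c hc
  have hm : (1 : ℝ) ≤ magnitude p k o (stage c) := by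
    exact_mod_cast magnitude_pos p k o (by have := two_le_stage c; omega : 1 ≤ stage c)
  rw [lt_div_iff₀ (by linarith)] at hc
  linarith

lemma Leads.div_tendsto_zero {g : ℕ → ℝ} {p k o : ℕ} {l : ℝ} (h : Leads g p k o l) :
    Tendsto (fun c : ℕ => blockSum g c / c) atTop (𝓝 0) := by
  have h1 : Tendsto (fun c => (l + 1) / (stage c : ℝ)) atTop (𝓝 0) :=
    (tendsto_const_div_atTop_nhds_zero_nat (l + 1)).comp tendsto_stage
  refine squeeze_zero' (Eventually.of_forall fun c =>
    div_nonneg (Finset.sum_nonneg fun i _ => h.nonneg i) (Nat.cast_nonneg _)) ?_ h1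
  filter_upwards [h.tendsto.eventually_lt_const (by linarith : l < l + 1), stage_pow_le,
    eventually_gt_atTop 0] with c hc hs hc0
  have hb := two_le_stage c
  have hm := magnitude_stage_pos p k o c
  rw [div_lt_iff₀ hm] at hc
  have hle : magnitude p k o (stage c) * stage c ≤ c := by
    calc _ ≤ stage c ^ (5 * stage c) * stage c :=
          Nat.mul_le_mul_right _ (magnitude_le p k o (by omega))
      _ = stage c ^ (5 * stage c + 1) := (pow_succ _ _).symm
      _ ≤ _ := (Nat.pow_le_pow_right (by omega) (by omega)).trans hs
  have hleR : (magnitude p k o (stage c) : ℝ) * stage c ≤ c := by exact_mod_cast hle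
  rw [div_le_div_iff₀ (by exact_mod_cast hc0) (by exact_mod_cast (by omega : 0 < stage c))]
  have hl := h.one_le
  calc blockSum g c * stage c ≤ (l + 1) * magnitude p k o (stage c) * stage c :=
        mul_le_mul_of_nonneg_right hc.le (Nat.cast_nonneg _)
    _ = (l + 1) * (magnitude p k o (stage c) * stage c) := by ring
    _ ≤ _ := mul_le_mul_of_nonneg_left hleR (by linarith)

lemma Leads.tendsto_ratio {g₁ g₂ : ℕ → ℝ} {p k o₁ o₂ : ℕ} {l₁ l₂ : ℝ} (h₁ : Leads g₁ p k o₁ l₁)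
    (h₂ : Leads g₂ p k o₂ l₂) {ρ : ℝ}
    (hρ : Tendsto (fun b => (magnitude p k o₁ b : ℝ) / magnitude p k o₂ b) atTop (𝓝 ρ)) :
    Tendsto (fun N => (∑ n ∈ Finset.range N, g₁ n) / ∑ n ∈ Finset.range N, g₂ n) atTop
      (𝓝 (l₁ / l₂ * ρ)) := by
  refine (tendsto_ratio_of_blocks h₁.nonneg h₂.nonneg blockStart_strictMono ?_ h₂.half_le
    h₂.div_tendsto_zero).1
  have h := (h₁.tendsto.div h₂.tendsto (by linarith [h₂.one_le])).mul (hρ.comp tendsto_stage)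
  refine h.congr' (Eventually.of_forall fun c => ?_)
  have e1 := (magnitude_stage_pos p k o₁ c).ne'
  have e2 := (magnitude_stage_pos p k o₂ c).ne'
  simp only [Pi.div_apply, Function.comp]
  change _ = blockSum g₁ c / blockSum g₂ c
  by_cases hz : blockSum g₂ c = 0
  · simp [hz]
  · field_simp

lemma Leads.tendsto_ratio_of_eq {g₁ g₂ : ℕ → ℝ} {p k o : ℕ} {l₁ l₂ : ℝ} (h₁ : Leads g₁ p k o l₁)
    (h₂ : Leads g₂ p k o l₂) :
    Tendsto (fun N => (∑ n ∈ Finset.range N, g₁ n) / ∑ n ∈ Finset.range N, g₂ n) atTop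
      (𝓝 (l₁ / l₂)) := by
  rw [← mul_one (l₁ / l₂)]
  refine h₁.tendsto_ratio h₂ (tendsto_const_nhds.congr' ?_)
  filter_upwards [eventually_ge_atTop 1] with b hb
  rw [div_self]
  have := magnitude_pos p k o hb
  exact_mod_cast (by omega : magnitude p k o b ≠ 0)

lemma Leads.tendsto_ratio_of_lt {g₁ g₂ : ℕ → ℝ} {p k o₁ o₂ : ℕ} {l₁ l₂ : ℝ}
    (h₁ : Leads g₁ p k o₁ l₁) (h₂ : Leads g₂ p k o₂ l₂) (hlt : o₂ < o₁) :
    Tendsto (fun N => (∑ n ∈ Finset.range N, g₁ n) / ∑ n ∈ Finset.range N, g₂ n) atTop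
      (𝓝 0) := by
  rw [← mul_zero (l₁ / l₂)]
  refine h₁.tendsto_ratio h₂ ?_
  refine squeeze_zero' (Eventually.of_forall fun b => by positivity) ?_
    (tendsto_const_div_atTop_nhds_zero_nat (1 : ℝ))
  filter_upwards [eventually_gt_atTop (o₁ + p)] with b hb
  have h3 : magnitude p k o₁ b * b ≤ magnitude p k o₂ b := by
    calc _ = b ^ (4 * (b - (o₁ + p)) + 1) * b ^ (b - k) := by rw [magnitude, pow_succ]; ring
      _ ≤ _ := Nat.mul_le_mul_right _ (Nat.pow_le_pow_right (by omega) (by omega))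
  have h4 := magnitude_pos p k o₂ (by omega : 1 ≤ b)
  rw [div_le_div_iff₀ (by exact_mod_cast h4) (by exact_mod_cast (by omega : 0 < b)), one_mul]
  exact_mod_cast h3

lemma Leads.tendsto_atTop {g : ℕ → ℝ} {p k o : ℕ} {l : ℝ} (h : Leads g p k o l) :
    Tendsto (fun N => ∑ n ∈ Finset.range N, g n) atTop atTop := by
  refine (tendsto_ratio_of_blocks (L := 1) h.nonneg h.nonneg blockStart_strictMono ?_ h.half_le
    h.div_tendsto_zero).2
  refine tendsto_const_nhds.congr' ?_
  filter_upwards [h.half_le] with c hc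
  change 1 = blockSum g c / blockSum g c
  rw [div_self (by linarith)]

end Leading

/-! ### Normality and abnormality of admissible digit sequences -/

section Normality

/-- The indicator of an occurrence of `B`, with digits `gap` apart, at `n ≡ r (mod m)`. -/
noncomputable def matchInd (E : ℕ → ℕ) (gap m r : ℕ) {k : ℕ} (B : Fin k → ℕ) (n : ℕ) : ℝ :=
  if n % m = r ∧ ∀ j : Fin k, E (n + j * gap) = B j then 1 else 0

/-- The expected frequency at `n ≡ r (mod m)` of a block of length `k`. -/
noncomputable def weight (S : Set ℕ) (m r k n : ℕ) : ℝ :=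
  if n % m = r then (∏ i ∈ Finset.range k, (seqQ S (n + i) : ℝ))⁻¹ else 0

lemma leads_matchInd {S : Set ℕ} {E : ℕ → ℕ} (hE : Admissible S E) {k gap m r o : ℕ} (hk : 1 ≤ k)
    (hgap : 1 ≤ gap) (hm : 1 ≤ m) (B : Fin k → ℕ) (ho : (o + 1) % m = r)
    (hmin : ∀ o', (o' + 1) % m = r → o ≤ o') :
    Leads (matchInd E gap m r B) ((k - 1) * gap) k o 1 := by
  have heq : ∀ᶠ c in atTop, blockSum (matchInd E gap m r B) c =
      mainSum (fun _ => 1) (fun o => (o + 1) % m = r) ((k - 1) * gap) k (stage c) := by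
    filter_upwards [stage_pow_le, eventually_gt_atTop (k * gap), eventually_ge_atTop m,
      tendsto_stage.eventually_gt_atTop (∑ j, B j + 2)] with c hc hkg hmc hBc
    have hB : ∀ j, B j + 2 < stage c := fun j => by
      have := Finset.single_le_sum (f := B) (fun i _ => Nat.zero_le _) (Finset.mem_univ j)
      omega
    have h1 := sum_matches_even (r := r) hE hk hgap hm hc hB hkg hmc
    have h2 := sum_matches_odd (m := m) (r := r) (gap := gap) hE hk hc hB
    have h3 : blockSum (matchInd E gap m r B) c = ((∑ n ∈ Finset.Ico (2 * c).factorial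
        (2 * c + 1 + 1).factorial,
        (if n % m = r ∧ ∀ j : Fin k, E (n + j * gap) = B j then 1 else 0) : ℕ) : ℝ) := by
      push_cast; rfl
    rw [h3, ← Finset.sum_Ico_consecutive _ (Nat.factorial_le (Nat.le_succ (2 * c)))
      (Nat.factorial_le (Nat.le_succ (2 * c + 1))), h1, h2, add_zero]
  have h := leads_of_mainSum (g := matchInd E gap m r B) (κ := fun _ => 1)
    (O := fun o => (o + 1) % m = r) (o₀ := o) (p := (k - 1) * gap) (k := k)
    (fun n => by unfold matchInd; split_ifs <;> norm_num) (fun _ => by norm_num) le_rfl ho hmin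
    (heq.mono fun c hc => hc.ge) (heq.mono fun c hc => by rw [hc]; simp)
  simpa using h

lemma leads_weight (S : Set ℕ) {k m r : ℕ} (hk : 1 ≤ k) (hr : r < m) :
    Leads (weight S m r k) (k - 1) k r (kap S (r + k)) := by
  have hmain : ∀ᶠ c in atTop,
      (mainSum (fun o => kap S (o + k)) (fun o => o % m = r) (k - 1) k (stage c) : ℝ) ≤
        blockSum (weight S m r k) c ∧ blockSum (weight S m r k) c ≤
      mainSum (fun o => kap S (o + k)) (fun o => o % m = r) (k - 1) k (stage c) +
        2 * (1 / 2) ^ c := by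
    filter_upwards [stage_pow_le, eventually_gt_atTop k, eventually_ge_atTop m] with c hc hkc hmc
    have h1 := sum_weight_odd (S := S) (r := r) hk (by omega) hc hkc hmc rfl rfl
    have h2 := sum_weight_even (S := S) (m := m) (r := r) (c := c) hk
    have h3 : blockSum (weight S m r k) c = ∑ n ∈ Finset.Ico (2 * c).factorial
        (2 * c + 1 + 1).factorial,
        if n % m = r then (∏ i ∈ Finset.range k, (seqQ S (n + i) : ℝ))⁻¹ else 0 := rfl
    have h4 := sum_Ico_half_pow_le (2 * c).factorial (2 * c + 1 + 1).factorial
    have h5 : (1 / 2 : ℝ) ^ (2 * c).factorial ≤ (1 / 2) ^ c :=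
      pow_le_pow_of_le_one (by norm_num) (by norm_num)
        ((by omega : c ≤ 2 * c).trans (Nat.self_le_factorial _))
    have h6 : 0 ≤ ∑ n ∈ Finset.Ico (2 * c).factorial (2 * c + 1).factorial,
        (if n % m = r then (∏ i ∈ Finset.range k, (seqQ S (n + i) : ℝ))⁻¹ else 0) :=
      Finset.sum_nonneg fun n _ => by
        split_ifs
        · exact inv_prod_seqQ_nonneg _ _ _
        · exact le_rfl
    have f1 := Nat.factorial_le (Nat.le_succ (2 * c))
    have f2 := Nat.factorial_le (Nat.le_succ (2 * c + 1))
    rw [← Finset.sum_Ico_consecutive _ f1 f2] at h3 h4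
    rw [h3]
    constructor <;> linarith [h1.1, h1.2]
  exact leads_of_mainSum (fun n => by
      unfold weight; split_ifs
      · exact inv_prod_seqQ_nonneg _ _ _
      · exact le_rfl) (κ := fun o => kap S (o + k)) (fun o => kap_le_two S _) (one_le_kap S _)
    (O := fun o => o % m = r) (Nat.mod_eq_of_lt hr)
    (fun o ho => by rw [← ho]; exact Nat.mod_le _ _) (hmain.mono fun c hc => hc.1)
    (hmain.mono fun c hc => hc.2)

/-- The least `o` with `o + 1 ≡ r (mod m)`. -/
def firstOffset (m r : ℕ) : ℕ := if r = 0 then m - 1 else r - 1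

lemma firstOffset_spec {m r : ℕ} (hr : r < m) : (firstOffset m r + 1) % m = r := by
  unfold firstOffset
  split_ifs with h
  · rw [Nat.sub_add_cancel (by omega), Nat.mod_self, h]
  · rw [Nat.sub_add_cancel (by omega), Nat.mod_eq_of_lt hr]

lemma firstOffset_le {m r o : ℕ} (ho : (o + 1) % m = r) : firstOffset m r ≤ o := by
  unfold firstOffset
  split_ifs with h
  · subst h
    have := Nat.le_of_dvd (by omega) (Nat.dvd_of_mod_eq_zero ho)
    omega
  · have := Nat.mod_le (o + 1) m
    omega

lemma Admissible.leads {S : Set ℕ} {E : ℕ → ℕ} (hE : Admissible S E) {k gap m r : ℕ} (hk : 1 ≤ k)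
    (hgap : 1 ≤ gap) (hr : r < m) (B : Fin k → ℕ) :
    Leads (matchInd E gap m r B) ((k - 1) * gap) k (firstOffset m r) 1 :=
  leads_matchInd hE hk hgap (by omega) B (firstOffset_spec hr) fun _ => firstOffset_le

lemma sum_range_mod_eq (F : ℕ → ℝ) {m r : ℕ} (hr : r < m) (n : ℕ) :
    ∑ i ∈ Finset.range (n * m), (if i % m = r then F i else 0) =
      ∑ t ∈ Finset.range n, F (m * t + r) := by
  rw [sum_range_mul_eq]
  refine Finset.sum_congr rfl fun t _ => ?_
  rw [Finset.sum_eq_single_of_mem r (Finset.mem_range.mpr hr)]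
  · rw [if_pos (by rw [Nat.mul_add_mod', Nat.mod_eq_of_lt hr]), mul_comm]
  · intro e he hne
    rw [if_neg (by rwa [Nat.mul_add_mod', Nat.mod_eq_of_lt (Finset.mem_range.mp he)])]

variable {S : Set ℕ} {E : ℕ → ℕ} {x : ℝ}

lemma apCount_eq (hx : ∀ n, qdigit (seqQ S) x n = E n) (m r : ℕ) (B : Fin m → ℕ) (n : ℕ) :
    (apCount (seqQ S) x m r B n : ℝ) = ∑ i ∈ Finset.range n, matchInd E 1 m r B i := by
  rw [apCount, Finset.card_filter]
  push_cast
  refine Finset.sum_congr rfl fun i _ => ?_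
  unfold matchInd
  simp only [hx, mul_one]

lemma blockCount_eq (hx : ∀ n, qdigit (seqQ S) x n = E n) {k : ℕ} (B : Fin k → ℕ) (n : ℕ) :
    (blockCount (seqQ S) x B n : ℝ) = ∑ i ∈ Finset.range n, matchInd E 1 1 0 B i := by
  rw [blockCount, Finset.card_filter]
  push_cast
  refine Finset.sum_congr rfl fun i _ => ?_
  unfold matchInd
  simp only [hx, mul_one, Nat.mod_one, true_and]

lemma Qsum_eq (S : Set ℕ) (k n : ℕ) :
    Qsum (seqQ S) k n = ∑ i ∈ Finset.range n, weight S 1 0 k i := by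
  refine Finset.sum_congr rfl fun i _ => ?_
  rw [weight, if_pos (Nat.mod_one i)]

lemma blockCount_Ups_eq (hx : ∀ n, qdigit (seqQ S) x n = E n) (hE : Admissible S E)
    {k m r : ℕ} (hr : r < m) (B : Fin k → ℕ) (n : ℕ) :
    (blockCount (lamQ (seqQ S) m r) (Ups (seqQ S) m r x) B n : ℝ) =
      ∑ i ∈ Finset.range (n * m), matchInd E m m r B i := by
  have hle : ∀ n, qdigit (seqQ S) x n + 2 ≤ seqQ S n := fun n => by
    rw [hx]; have := lowDigit_add_le S n; have := hE n; omega
  rw [blockCount, Finset.card_filter]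
  push_cast
  have h := sum_range_mod_eq (fun i => if ∀ j : Fin k, E (i + j * m) = B j then (1 : ℝ) else 0) hr n
  simp_rw [← ite_and] at h
  unfold matchInd
  rw [h]
  refine Finset.sum_congr rfl fun t _ => ?_
  simp only [qdigit_Ups (isBasic_seqQ S) hle, hx]
  refine if_congr (forall_congr' fun j => ?_) rfl rfl
  rw [show m * (t + (j : ℕ)) + r = m * t + r + j * m by ring]

lemma apQsum_eq (S : Set ℕ) {m r : ℕ} (hr : r < m) (n : ℕ) :
    apQsum (seqQ S) m r n =
      ∑ i ∈ Finset.range (((n - r) / m + 1) * m), weight S m r m i := by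
  unfold weight
  rw [sum_range_mod_eq (fun i => (∏ j ∈ Finset.range m, (seqQ S (i + j) : ℝ))⁻¹) hr, apQsum]

theorem fullyDivergent_seqQ (S : Set ℕ) : FullyDivergent (seqQ S) := fun k hk => by
  simp_rw [Qsum_eq]
  exact (leads_weight S hk Nat.zero_lt_one).tendsto_atTop

lemma tendsto_blockCount_div_Qsum (hx : ∀ n, qdigit (seqQ S) x n = E n) (hE : Admissible S E)
    {k : ℕ} (hk : 1 ≤ k) (B : Fin k → ℕ) :
    Tendsto (fun n => (blockCount (seqQ S) x B n : ℝ) / Qsum (seqQ S) k n) atTop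
      (𝓝 (1 / kap S k)) := by
  have h1 := hE.leads (gap := 1) hk le_rfl Nat.zero_lt_one B
  have h2 := leads_weight S hk Nat.zero_lt_one
  rw [mul_one] at h1
  rw [zero_add] at h2
  simp_rw [blockCount_eq hx, Qsum_eq]
  exact h1.tendsto_ratio_of_eq h2

theorem Admissible.qNormalOfOrder_iff (hx : ∀ n, qdigit (seqQ S) x n = E n)
    (hE : Admissible S E) {k : ℕ} (hk : 1 ≤ k) : QNormalOfOrder (seqQ S) k x ↔ k ∈ S := by
  constructor
  · intro h
    by_contra hkS
    have h1 := tendsto_nhds_unique (h fun _ => 0)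
      (tendsto_blockCount_div_Qsum hx hE hk fun _ => 0)
    rw [kap, if_neg hkS] at h1
    norm_num at h1
  · intro hkS B
    have := tendsto_blockCount_div_Qsum hx hE hk B
    rw [kap, if_pos hkS] at this
    simpa using this

theorem Admissible.memRNI (hx : ∀ n, qdigit (seqQ S) x n = E n) (hE : Admissible S E) :
    MemRNI (seqQ S) x := fun m hm r hr B₁ B₂ => by
  simp_rw [apCount_eq hx]
  simpa using (hE.leads hm le_rfl hr B₁).tendsto_ratio_of_eq (hE.leads hm le_rfl hr B₂)

theorem Admissible.memRNII (hx : ∀ n, qdigit (seqQ S) x n = E n) (hE : Admissible S E) :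
    MemRNII (seqQ S) x := fun k hk m hm r hr B₁ B₂ => by
  simp_rw [blockCount_Ups_eq hx hE hr]
  have h := (hE.leads hk hm hr B₁).tendsto_ratio_of_eq (hE.leads hk hm hr B₂)
  rw [div_one] at h
  exact h.comp (tendsto_id.atTop_mul_const' hm)

theorem Admissible.not_apNormalII (hx : ∀ n, qdigit (seqQ S) x n = E n) (hE : Admissible S E) :
    ¬ APNormalII (seqQ S) x := fun hN => by
  have h := hN 1 le_rfl 2 (by norm_num) 0 (by norm_num) fun _ => 0
  have h1 := hE.leads (gap := 2) (m := 2) (r := 0) le_rfl (by norm_num) (by norm_num)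
    (fun _ : Fin 1 => 0)
  have h2 := leads_weight S (k := 1) (m := 2) (r := 0) le_rfl (by norm_num)
  have h3 := (h1.tendsto_ratio_of_lt h2 (by simp [firstOffset])).comp
    (tendsto_id.atTop_mul_const' (by norm_num : 0 < 2))
  have h4 : ∀ n, Qsum (lamQ (seqQ S) 2 0) 1 n =
      ∑ i ∈ Finset.range (n * 2), weight S 2 0 1 i := fun n => by
    unfold weight
    rw [sum_range_mod_eq (fun i => (∏ j ∈ Finset.range 1, (seqQ S (i + j) : ℝ))⁻¹) (by norm_num)]
    simp [Qsum, lamQ]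
  simp_rw [blockCount_Ups_eq hx hE (by norm_num : 0 < 2), h4] at h
  exact zero_ne_one (tendsto_nhds_unique h3 h)

theorem Admissible.apAbnormalI (hx : ∀ n, qdigit (seqQ S) x n = E n) (hE : Admissible S E) :
    APAbnormalI (seqQ S) x := fun m hm r hr hN => by
  have h := hN fun _ => 0
  have h1 := hE.leads (k := m) (gap := 1) (by omega) le_rfl hr (fun _ => 0)
  have h2 := leads_weight S (k := m) (by omega) hr
  rw [mul_one] at h1
  simp_rw [apCount_eq hx, apQsum_eq S hr] at h
  have hmul : Tendsto (fun s : ℕ => s * m) atTop atTop :=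
    tendsto_id.atTop_mul_const' (by omega : 0 < m)
  have h' := h.comp hmul
  rcases Nat.eq_zero_or_pos r with rfl | hr0
  · have hlt : 0 < firstOffset m 0 := by simp only [firstOffset, if_true]; omega
    have h3 := (h1.tendsto_ratio_of_lt h2 hlt).comp (hmul.comp (tendsto_add_atTop_nat 1))
    refine zero_ne_one (tendsto_nhds_unique (squeeze_zero (fun s => ?_) (fun s => ?_) h3) h')
    · exact div_nonneg (Finset.sum_nonneg fun i _ => h1.nonneg i)
        (Finset.sum_nonneg fun i _ => h2.nonneg i)
    · simp only [Function.comp]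
      have e : (s * m - 0) / m + 1 = s + 1 := by
        rw [Nat.sub_zero, Nat.mul_div_cancel _ (by omega)]
      rw [e]
      refine div_le_div_of_nonneg_right ?_ (Finset.sum_nonneg fun i _ => h2.nonneg i)
      exact Finset.sum_le_sum_of_subset_of_nonneg
        (Finset.range_mono (Nat.mul_le_mul_right _ (by omega))) fun i _ _ => h1.nonneg i
  · have hlt : firstOffset m r < r := by unfold firstOffset; split_ifs <;> omega
    have h3 := (h2.tendsto_ratio_of_lt h1 hlt).comp hmul
    have h4 := h'.inv₀ one_ne_zero
    rw [inv_one] at h4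
    refine zero_ne_one (tendsto_nhds_unique h3 (h4.congr' ?_))
    filter_upwards [eventually_ge_atTop 1] with s hs
    simp only [Function.comp]
    have e : (s * m - r) / m + 1 = s := by
      obtain ⟨s, rfl⟩ := Nat.exists_eq_add_of_le' hs
      rw [show (s + 1) * m - r = (m - r) + s * m by rw [Nat.succ_mul]; omega,
        Nat.add_mul_div_right _ _ (by omega), Nat.div_eq_of_lt (by omega), zero_add]
    rw [e, inv_div]

end Normality

/-! ### Density of the exceptional positions -/

section Density

/-- The number of exceptional positions below `n`. -/
noncomputable def pinCount (S : Set ℕ) (n : ℕ) : ℕ :=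
  ((Finset.range n).filter fun i => IsD S i ∨ IsA i).card

lemma cyc_mono : Monotone cyc := fun a b h => by
  rcases Nat.eq_zero_or_pos a with rfl | ha
  · simp [cyc]
  · exact le_cyc ((factorial_cyc_le ha).trans h)

lemma pinCount_le (S : Set ℕ) (n : ℕ) : pinCount S n ≤ (cyc n + 3) ^ 3 := by
  have hmaps : ∀ i ∈ (Finset.range n).filter (fun i => IsD S i ∨ IsA i),
      (cyc i, i / (cyc i).factorial, off i) ∈ Finset.range (cyc n + 3) ×ˢ
        Finset.range (cyc n + 3) ×ˢ Finset.range (cyc n + 3) := by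
    intro i hi
    rw [Finset.mem_filter, Finset.mem_range] at hi
    have h1 : cyc i ≤ cyc n := cyc_mono hi.1.le
    have h2 : i / (cyc i).factorial < cyc i + 1 := by
      rw [Nat.div_lt_iff_lt_mul (Nat.factorial_pos _), ← Nat.factorial_succ]
      exact lt_factorial_cyc i
    have h3 : off i ≤ base i := hi.2.elim (fun h => h.2.1.le) fun h => h.2.2.1
    have h4 : base i ≤ max 2 (cyc i / 2) := stage_le _
    simp only [Finset.mem_product, Finset.mem_range]
    omega
  have hinj : Set.InjOn (fun i => (cyc i, i / (cyc i).factorial, off i))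
      ((Finset.range n).filter (fun i => IsD S i ∨ IsA i) : Set ℕ) := by
    intro i _ j _ hij
    simp only [Prod.mk.injEq, off] at hij
    obtain ⟨h1, h2, h3⟩ := hij
    rw [← Nat.div_add_mod i (cyc i).factorial, h2, h3, h1, Nat.div_add_mod]
  refine (Finset.card_le_card_of_injOn _ hmaps hinj).trans (le_of_eq ?_)
  simp only [Finset.card_product, Finset.card_range]
  ring

lemma tendsto_pinCount_div (S : Set ℕ) :
    Tendsto (fun n : ℕ => (pinCount S n : ℝ) / n) atTop (𝓝 0) := by
  have h1 : Tendsto (fun c : ℕ => 27 * ((8 : ℝ) ^ c / c.factorial)) atTop (𝓝 0) := by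
    simpa using (FloorSemiring.tendsto_pow_div_factorial_atTop (8 : ℝ)).const_mul 27
  refine squeeze_zero' (Eventually.of_forall fun n => by positivity) ?_ (h1.comp tendsto_cyc)
  filter_upwards [eventually_ge_atTop 1] with n hn
  have hf : (0 : ℝ) < (cyc n).factorial := by exact_mod_cast Nat.factorial_pos _
  have hfn : ((cyc n).factorial : ℝ) ≤ n := by exact_mod_cast factorial_cyc_le hn
  have h2 : (cyc n + 3) ^ 3 ≤ 27 * 8 ^ cyc n := by
    have h := Nat.lt_two_pow_self (n := cyc n)
    calc (cyc n + 3) ^ 3 ≤ (3 * 2 ^ cyc n) ^ 3 := Nat.pow_le_pow_left (by omega) 3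
      _ = 27 * 8 ^ cyc n := by rw [mul_pow, ← pow_mul, mul_comm (cyc n) 3, pow_mul]; norm_num
  have h3 : (pinCount S n : ℝ) ≤ 27 * 8 ^ cyc n := by
    exact_mod_cast (pinCount_le S n).trans h2
  simp only [Function.comp]
  rw [← mul_div_assoc]
  exact div_le_div₀ (by positivity) h3 hf hfn

end Density

/-! ### Van der Corput numbering and uniform distribution -/

section Distribution

lemma mod_eq_of_corput_eq {M n n' : ℕ} (h : corput M n = corput M n') :
    n % M.factorial = n' % M.factorial := by
  induction M with
  | zero => simp [Nat.mod_one]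
  | succ M ih =>
    simp only [corput] at h
    have h1 : n / M.factorial % (M + 1) < M + 1 := Nat.mod_lt _ (by omega)
    have h2 : n' / M.factorial % (M + 1) < M + 1 := Nat.mod_lt _ (by omega)
    have h3 : corput M n = corput M n' := by
      have := congrArg (· / (M + 1)) h
      simp only [Nat.mul_add_div (by omega : M + 1 > 0), Nat.div_eq_of_lt h1,
        Nat.div_eq_of_lt h2] at this
      omega
    rw [h3] at h
    have h4 := ih h3
    rw [Nat.factorial_succ, mul_comm (M + 1), Nat.mod_mul, Nat.mod_mul, h4]
    congr 2; omega

lemma corput_nested {M c : ℕ} (h : M ≤ c) (n : ℕ) :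
    corput M n * c.factorial ≤ corput c n * M.factorial ∧
      (corput c n + 1) * M.factorial ≤ (corput M n + 1) * c.factorial := by
  induction c, h using Nat.le_induction with
  | base => exact ⟨le_rfl, le_rfl⟩
  | succ c hc ih =>
    have hd : n / c.factorial % (c + 1) < c + 1 := Nat.mod_lt _ (by omega)
    rw [corput, Nat.factorial_succ]
    set d := n / c.factorial % (c + 1)
    constructor
    · calc corput M n * ((c + 1) * c.factorial) = (c + 1) * (corput M n * c.factorial) := by ring
        _ ≤ (c + 1) * (corput c n * M.factorial) := Nat.mul_le_mul_left _ ih.1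
        _ ≤ (c + 1) * (corput c n * M.factorial) + d * M.factorial := Nat.le_add_right _ _
        _ = _ := by ring
    · calc ((c + 1) * corput c n + d + 1) * M.factorial
          ≤ ((c + 1) * corput c n + (c + 1)) * M.factorial := Nat.mul_le_mul_right _ (by omega)
        _ = (c + 1) * ((corput c n + 1) * M.factorial) := by ring
        _ ≤ (c + 1) * ((corput M n + 1) * c.factorial) := Nat.mul_le_mul_left _ ih.2
        _ = _ := by ring

lemma card_corput_mem_le (M N : ℕ) (J : Finset ℕ) :
    ((Finset.range N).filter fun n => corput M n ∈ J).card ≤ (N / M.factorial + 1) * J.card := by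
  have hmaps : ∀ n ∈ (Finset.range N).filter (fun n => corput M n ∈ J),
      (n / M.factorial, corput M n) ∈ Finset.range (N / M.factorial + 1) ×ˢ J := by
    intro n hn
    rw [Finset.mem_filter, Finset.mem_range] at hn
    simp only [Finset.mem_product, Finset.mem_range]
    exact ⟨Nat.lt_succ_of_le (Nat.div_le_div_right hn.1.le), hn.2⟩
  refine (Finset.card_le_card_of_injOn _ hmaps ?_).trans (by simp)
  intro n _ n' _ h
  simp only [Prod.mk.injEq] at h
  rw [← Nat.div_add_mod n M.factorial, h.1, mod_eq_of_corput_eq h.2, Nat.div_add_mod]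

lemma card_le_of_mem_Icc {J : Finset ℕ} {s t : ℝ} (hst : s ≤ t)
    (h : ∀ j ∈ J, s ≤ j ∧ (j : ℝ) ≤ t) : (J.card : ℝ) ≤ t - s + 1 := by
  rcases J.eq_empty_or_nonempty with rfl | hJ
  · simp; linarith
  · have hsub : J ⊆ Finset.Icc (J.min' hJ) (J.max' hJ) := fun j hj =>
      Finset.mem_Icc.mpr ⟨Finset.min'_le J j hj, Finset.le_max' J j hj⟩
    have h1 := Finset.card_le_card hsub
    rw [Nat.card_Icc] at h1
    have h2 := (h _ (Finset.min'_mem J hJ)).1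
    have h3 := (h _ (Finset.max'_mem J hJ)).2
    have h4 : J.min' hJ ≤ J.max' hJ := Finset.min'_le_max' J hJ
    have h5 : (J.card : ℝ) ≤ J.max' hJ + 1 - J.min' hJ := by
      rw [le_sub_iff_add_le]
      exact_mod_cast (by omega : J.card + J.min' hJ ≤ J.max' hJ + 1)
    linarith

lemma udMod1_of_eventually_le {u : ℕ → ℝ} (h0 : ∀ n, 0 ≤ u n) (h1 : ∀ n, u n < 1)
    (h : ∀ a b : ℝ, 0 ≤ a → a ≤ b → b ≤ 1 → ∀ ε > 0, ∀ᶠ N : ℕ in atTop,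
      (((Finset.range N).filter fun n => u n ∈ Set.Ico a b).card : ℝ) / N ≤ b - a + ε) :
    UDMod1 u := by
  intro a b ha hab hb
  have hsplit : ∀ N : ℕ, 0 < N →
      (((Finset.range N).filter fun n => u n ∈ Set.Ico 0 a).card : ℝ) / N +
      (((Finset.range N).filter fun n => u n ∈ Set.Ico a b).card : ℝ) / N +
      (((Finset.range N).filter fun n => u n ∈ Set.Ico b 1).card : ℝ) / N = 1 := by
    intro N hN
    rw [← add_div, ← add_div, div_eq_one_iff_eq (by positivity)]
    rw [Finset.card_filter, Finset.card_filter, Finset.card_filter]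
    push_cast
    rw [← Finset.sum_add_distrib, ← Finset.sum_add_distrib]
    have : ∀ n ∈ Finset.range N, ((if u n ∈ Set.Ico 0 a then (1 : ℝ) else 0) +
        (if u n ∈ Set.Ico a b then 1 else 0) + if u n ∈ Set.Ico b 1 then 1 else 0) = 1 := by
      intro n _
      have e0 := h0 n
      have e1 := h1 n
      simp only [Set.mem_Ico]
      rcases lt_or_ge (u n) a with g | g
      · rw [if_pos ⟨e0, g⟩, if_neg (by intro g'; linarith [g'.1]),
          if_neg (by intro g'; linarith [g'.1])]; norm_num
      · rcases lt_or_ge (u n) b with g' | g'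
        · rw [if_neg (by intro g''; linarith [g''.2]), if_pos ⟨g, g'⟩,
            if_neg (by intro g''; linarith [g''.1])]; norm_num
        · rw [if_neg (by intro g''; linarith [g''.2]), if_neg (by intro g''; linarith [g''.2]),
            if_pos ⟨g', e1⟩]; norm_num
    rw [Finset.sum_congr rfl this]; simp
  rw [Metric.tendsto_atTop']
  intro ε hε
  obtain ⟨N₀, hN₀⟩ := eventually_atTop.mp ((h 0 a le_rfl ha (by linarith) (ε / 3) (by linarith)).and
    ((h a b ha hab.le hb (ε / 3) (by linarith)).and
      (h b 1 (by linarith) hb le_rfl (ε / 3) (by linarith))))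
  refine ⟨N₀, fun N hN => ?_⟩
  obtain ⟨g1, g2, g3⟩ := hN₀ N hN.le
  have := hsplit N (by omega)
  rw [Real.dist_eq, abs_lt]
  constructor <;> linarith

end Distribution

/-! ### Distribution of the tails -/

section Tails

variable {S : Set ℕ} {E : ℕ → ℕ}

lemma Admissible.add_two_le (hE : Admissible S E) (n : ℕ) : E n + 2 ≤ seqQ S n := by
  have h1 := hE n
  have h2 := lowDigit_add_le S n
  omega

lemma Admissible.tail_bounds_cyc (hE : Admissible S E) {n : ℕ} (hn : ¬(IsD S n ∨ IsA n)) :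
    (corput (cyc n) n : ℝ) - 1 ≤ cantorTail (seqQ S) E n * (cyc n).factorial ∧
      cantorTail (seqQ S) E n * (cyc n).factorial ≤ corput (cyc n) n + 2 := by
  have hq := isBasic_seqQ S
  have hE1 : ∀ n, E n + 1 ≤ seqQ S n := fun n => by have := hE.add_two_le n; omega
  have hm := mul_cantorTail hq hE1 n
  have h0 := cantorTail_nonneg (E := E) hq n
  have h0' := cantorTail_nonneg (E := E) hq (n + 1)
  have h1' := cantorTail_le_one hq hE1 (n + 1)
  have hn1 : ¬ IsD S n := fun h => hn (Or.inl h)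
  have hn2 : ¬ IsA n := fun h => hn (Or.inr h)
  have hEn := hE n
  simp only [lowDigit, numDigits, if_neg hn1, if_neg hn2, if_neg hn] at hEn
  rw [seqQ, if_neg hn1] at hm
  have hj := corput_lt (cyc n) n
  set j := corput (cyc n) n
  set P := (cyc n).factorial
  set T := cantorTail (seqQ S) E n
  have e1 : (2 : ℝ) ^ n * (1 + j) ≤ E n := by exact_mod_cast hEn.1
  have e2 : (E n : ℝ) + 1 ≤ (2 : ℝ) ^ n * (1 + j) + 2 ^ n := by exact_mod_cast hEn.2
  have hj' : (j : ℝ) + 1 ≤ P := by exact_mod_cast hj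
  have hp : (0 : ℝ) < 2 ^ n := by positivity
  push_cast at hm
  have l1 : 1 + (j : ℝ) ≤ (P + 2) * T := by
    refine le_of_mul_le_mul_left (?_ : (2 : ℝ) ^ n * _ ≤ 2 ^ n * _) hp
    rw [← mul_assoc, hm]; linarith
  have l2 : ((P : ℝ) + 2) * T ≤ 2 + j := by
    refine le_of_mul_le_mul_left (?_ : (2 : ℝ) ^ n * _ ≤ 2 ^ n * _) hp
    rw [← mul_assoc, hm]; linarith
  have hT1 : T ≤ 1 := cantorTail_le_one hq hE1 n
  constructor <;> linarith

lemma Admissible.tail_bounds (hE : Admissible S E) {n M : ℕ} (hn : ¬(IsD S n ∨ IsA n))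
    (hM : M ≤ cyc n) {δ : ℝ} (hδ : (M.factorial : ℝ) ≤ δ * (cyc n).factorial) :
    (corput M n : ℝ) - δ ≤ cantorTail (seqQ S) E n * M.factorial ∧
      cantorTail (seqQ S) E n * M.factorial ≤ corput M n + 1 + δ := by
  obtain ⟨h1, h2⟩ := hE.tail_bounds_cyc hn
  obtain ⟨g1, g2⟩ := corput_nested hM n
  have g1' : (corput M n : ℝ) * (cyc n).factorial ≤ corput (cyc n) n * M.factorial := by
    exact_mod_cast g1
  have g2' : ((corput (cyc n) n : ℝ) + 1) * M.factorial ≤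
      (corput M n + 1) * (cyc n).factorial := by exact_mod_cast g2
  have hc : (0 : ℝ) < (cyc n).factorial := by exact_mod_cast Nat.factorial_pos _
  have hP : (0 : ℝ) < M.factorial := by exact_mod_cast Nat.factorial_pos _
  have k1 := mul_le_mul_of_nonneg_right h1 hP.le
  have k2 := mul_le_mul_of_nonneg_right h2 hP.le
  constructor
  · refine le_of_mul_le_mul_right (?_ : _ * ((cyc n).factorial : ℝ) ≤ _) hc
    nlinarith
  · refine le_of_mul_le_mul_right (?_ : _ * ((cyc n).factorial : ℝ) ≤ _) hc
    nlinarith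

lemma card_range_pinned (S : Set ℕ) (N : ℕ) {p : ℕ → Prop} [DecidablePred p] {A : ℕ}
    (h : ((Finset.range N).filter fun n => ¬(IsD S n ∨ IsA n) ∧ p n).card ≤ A) :
    ((Finset.range N).filter p).card ≤ pinCount S N + A := by
  refine (Finset.card_le_card (t := ((Finset.range N).filter fun i => IsD S i ∨ IsA i) ∪
    (Finset.range N).filter fun n => ¬(IsD S n ∨ IsA n) ∧ p n) ?_).trans
    ((Finset.card_union_le _ _).trans (Nat.add_le_add_left h _))
  intro i hi
  simp only [Finset.mem_union, Finset.mem_filter] at hi ⊢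
  by_cases g : IsD S i ∨ IsA i
  · exact Or.inl ⟨hi.1, g⟩
  · exact Or.inr ⟨hi.1, g, hi.2⟩

lemma Admissible.card_tail_mem_Ico_le (hE : Admissible S E) (M N : ℕ) {a b : ℝ} (hab : a ≤ b) :
    (((Finset.range N).filter fun n => cantorTail (seqQ S) E n ∈ Set.Ico a b).card : ℝ) ≤
      pinCount S N + M.factorial + (N / M.factorial + 1) * ((b - a) * M.factorial + 4) := by
  set P := M.factorial with hP
  have hP0 : (0 : ℝ) < P := by exact_mod_cast Nat.factorial_pos _
  set J := (Finset.range P).filter fun j : ℕ => a * P - 2 ≤ j ∧ (j : ℝ) ≤ b * P + 1 with hJ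
  have hJc : (J.card : ℝ) ≤ (b - a) * P + 4 := by
    have h := card_le_of_mem_Icc (J := J) (s := a * P - 2) (t := b * P + 1)
      (by nlinarith) fun j hj => (Finset.mem_filter.mp hj).2
    linarith
  have hcount : ((Finset.range N).filter fun n => ¬(IsD S n ∨ IsA n) ∧
      cantorTail (seqQ S) E n ∈ Set.Ico a b).card ≤ P + (N / P + 1) * J.card := by
    refine (Finset.card_le_card (t := Finset.range P ∪
      (Finset.range N).filter fun n => corput M n ∈ J) ?_).trans
      ((Finset.card_union_le _ _).trans (Nat.add_le_add (by simp) (card_corput_mem_le M N J)))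
    intro n hn
    simp only [Finset.mem_union, Finset.mem_filter, Finset.mem_range] at hn ⊢
    obtain ⟨hnN, hn1, hn2⟩ := hn
    rcases lt_or_ge n P with h | h
    · exact Or.inl h
    · refine Or.inr ⟨hnN, ?_⟩
      have hc : M ≤ cyc n := le_cyc h
      obtain ⟨t1, t2⟩ := hE.tail_bounds hn1 hc (δ := 1)
        (by rw [one_mul]; exact_mod_cast Nat.factorial_le hc)
      have k1 := mul_le_mul_of_nonneg_right hn2.1 hP0.le
      have k2 := mul_le_mul_of_nonneg_right hn2.2.le hP0.le
      rw [hJ, Finset.mem_filter, Finset.mem_range]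
      exact ⟨corput_lt M n, by linarith, by linarith⟩
  have h := card_range_pinned S N hcount
  have h' : (((Finset.range N).filter fun n => cantorTail (seqQ S) E n ∈ Set.Ico a b).card : ℝ) ≤
      pinCount S N + (P + ((N / P : ℕ) + 1) * J.card) := by exact_mod_cast h
  have hd : ((N / P : ℕ) : ℝ) ≤ N / P := Nat.cast_div_le
  have : (((N / P : ℕ) : ℝ) + 1) * J.card ≤ (N / P + 1) * ((b - a) * P + 4) :=
    mul_le_mul (by linarith) hJc (by positivity) (by positivity)
  linarith

lemma Admissible.distNormal (hE : Admissible S E) :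
    DistNormal (seqQ S) (cantorTail (seqQ S) E 0) := by
  have hq := isBasic_seqQ S
  have hT : (fun n => TQ (seqQ S) n (cantorTail (seqQ S) E 0)) = cantorTail (seqQ S) E :=
    funext fun n => TQ_cantorTail hq hE.add_two_le n
  rw [DistNormal, hT]
  refine udMod1_of_eventually_le (fun n => cantorTail_nonneg hq n)
    (fun n => cantorTail_lt_one hq hE.add_two_le n) fun a b ha hab hb ε hε => ?_
  obtain ⟨M, hM⟩ := exists_nat_gt (4 / (ε / 2))
  have hMP : (M : ℝ) ≤ M.factorial := by exact_mod_cast Nat.self_le_factorial M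
  have hP0 : (0 : ℝ) < M.factorial := by exact_mod_cast Nat.factorial_pos _
  have hPε : 4 / (M.factorial : ℝ) < ε / 2 := by
    rw [div_lt_iff₀ hP0]
    rw [div_lt_iff₀ (by linarith)] at hM
    nlinarith
  set P : ℝ := (M.factorial : ℝ)
  have hlim : Tendsto (fun N : ℕ => (pinCount S N : ℝ) / N + (P + ((b - a) * P + 4)) / N) atTop
      (𝓝 0) := by
    simpa using (tendsto_pinCount_div S).add
      (tendsto_const_div_atTop_nhds_zero_nat (P + ((b - a) * P + 4)))
  filter_upwards [hlim.eventually_lt_const (show 0 < ε / 2 by linarith), eventually_gt_atTop 0]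
    with N hN hN0
  have hN' : (0 : ℝ) < N := by exact_mod_cast hN0
  have hcard := hE.card_tail_mem_Ico_le M N hab
  have : (pinCount S N + P + (N / P + 1) * ((b - a) * P + 4)) / N =
      (pinCount S N : ℝ) / N + (P + ((b - a) * P + 4)) / N + (b - a) + 4 / P := by
    field_simp; ring
  have h2 := div_le_div_of_nonneg_right hcard hN'.le
  linarith

lemma Admissible.apDistAbnormal (hE : Admissible S E) :
    APDistAbnormal (seqQ S) (cantorTail (seqQ S) E 0) := by
  have hq := isBasic_seqQ S
  intro m hm r hr hud
  have hT : (fun n => TQ (seqQ S) (m * n + r) (cantorTail (seqQ S) E 0)) =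
      fun n => cantorTail (seqQ S) E (m * n + r) :=
    funext fun n => TQ_cantorTail hq hE.add_two_le _
  rw [hT] at hud
  set P := m.factorial with hP
  have hP0 : (0 : ℝ) < P := by exact_mod_cast Nat.factorial_pos _
  set j := corput m ((r + 1) % m) with hj
  have hjP : (j : ℝ) + 1 ≤ P := by exact_mod_cast corput_lt m _
  have hne : ∀ n, n % m = r → corput m n ≠ j := by
    intro n hn h
    have h1 := mod_eq_of_corput_eq h
    have h2 := congrArg (· % m) h1
    simp only [Nat.mod_mod_of_dvd _ (Nat.dvd_factorial (by omega : 0 < m) le_rfl), hn,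
      Nat.mod_mod] at h2
    rcases Nat.lt_or_ge (r + 1) m with g | g
    · rw [Nat.mod_eq_of_lt g] at h2; omega
    · have : r + 1 = m := by omega
      rw [this, Nat.mod_self] at h2; omega
  set a : ℝ := (j + 1 / 3) / P with ha
  set b : ℝ := (j + 2 / 3) / P with hb
  have hlim := hud a b (by positivity) (by rw [ha, hb]; gcongr; norm_num)
    (by rw [hb, div_le_one hP0]; linarith)
  set K := (m + 4 * P).factorial with hK
  have hcount : ∀ N : ℕ, ((Finset.range N).filter fun n =>
      cantorTail (seqQ S) E (m * n + r) ∈ Set.Ico a b).card ≤ pinCount S (m * N) + K := by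
    intro N
    refine le_trans (Finset.card_le_card_of_injOn (t := (Finset.range (m * N)).filter fun n =>
      n % m = r ∧ cantorTail (seqQ S) E n ∈ Set.Ico a b) (fun n => m * n + r) ?_ ?_)
      (card_range_pinned S (m * N) ?_)
    · intro n hn
      rw [Finset.mem_coe, Finset.mem_filter, Finset.mem_range] at hn
      rw [Finset.mem_coe, Finset.mem_filter, Finset.mem_range]
      refine ⟨by nlinarith, ?_, hn.2⟩
      rw [Nat.mul_add_mod, Nat.mod_eq_of_lt hr]
    · intro x _ y _ hxy
      exact Nat.eq_of_mul_eq_mul_left (by omega : 0 < m) (Nat.add_right_cancel hxy)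
    · refine (Finset.card_le_card (t := Finset.range K) ?_).trans (by simp)
      intro n hn
      simp only [Finset.mem_filter, Finset.mem_range] at hn ⊢
      obtain ⟨-, hn1, hn2, hn3⟩ := hn
      by_contra! hKn
      have hc : m + 4 * P ≤ cyc n := le_cyc hKn
      have hc4 : 4 * (P : ℝ) ≤ (cyc n).factorial := by
        exact_mod_cast ((Nat.le_add_left _ _).trans hc).trans (Nat.self_le_factorial _)
      obtain ⟨t1, t2⟩ := hE.tail_bounds hn1 (le_of_add_le_left hc) (δ := 1 / 4)
        (by rw [← hP]; linarith)
      have k1 : (j : ℝ) + 1 / 3 ≤ cantorTail (seqQ S) E n * P := (div_le_iff₀ hP0).mp hn3.1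
      have k2 : cantorTail (seqQ S) E n * P < (j : ℝ) + 2 / 3 := (lt_div_iff₀ hP0).mp hn3.2
      rcases lt_or_gt_of_ne (hne n hn2) with g | g
      · have : (corput m n : ℝ) + 1 ≤ j := by exact_mod_cast g
        linarith
      · have : (j : ℝ) + 1 ≤ corput m n := by exact_mod_cast g
        linarith
  have hm0 : (0 : ℝ) < m := by exact_mod_cast (by omega : 0 < m)
  have hzero : Tendsto (fun N : ℕ => (m : ℝ) * ((pinCount S (m * N) : ℝ) / (m * N : ℕ)) +
      (K : ℝ) / N) atTop (𝓝 0) := by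
    have h1 := ((tendsto_pinCount_div S).comp
      (tendsto_id.const_mul_atTop' (by omega : 0 < m))).const_mul (m : ℝ)
    simpa using h1.add (tendsto_const_div_atTop_nhds_zero_nat (K : ℝ))
  have hle := le_of_tendsto_of_tendsto hlim hzero (by
    filter_upwards [eventually_gt_atTop 0] with N hN
    have hN' : (0 : ℝ) < N := by exact_mod_cast hN
    have e : (m : ℝ) * ((pinCount S (m * N) : ℝ) / (m * N : ℕ)) + (K : ℝ) / N =
        (pinCount S (m * N) + K) / N := by
      push_cast; field_simp
    rw [e]
    gcongr
    exact_mod_cast hcount N)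
  have : b - a = 1 / 3 / P := by rw [ha, hb, ← sub_div]; ring
  have h3 : 0 < 1 / 3 / (P : ℝ) := by positivity
  linarith

end Tails

/-! ### Growth of the construction and dimension -/

section Dimension

lemma seqQ_le (S : Set ℕ) (n : ℕ) : seqQ S n ≤ 2 ^ n * (n + 3) := by
  have hf : (cyc n).factorial ≤ n + 1 := by
    rcases Nat.eq_zero_or_pos n with rfl | hn
    · simp [cyc]
    · exact (factorial_cyc_le hn).trans (Nat.le_succ n)
  have hb := base_le n
  have hp : 1 ≤ 2 ^ n := Nat.one_le_two_pow
  unfold seqQ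
  split_ifs
  · nlinarith
  · exact Nat.mul_le_mul_left _ (by omega)

lemma log_qprod {q : ℕ → ℕ} (hq : ∀ n, 1 ≤ q n) (n : ℕ) :
    Real.log (qprod q n) = ∑ i ∈ Finset.range n, Real.log (q i) :=
  Real.log_prod fun i _ => by exact_mod_cast (Nat.one_le_iff_ne_zero.mp (hq i))

lemma one_le_seqQ (S : Set ℕ) (n : ℕ) : 1 ≤ seqQ S n :=
  (by norm_num : 1 ≤ 2).trans (isBasic_seqQ S n)

lemma sum_range_cast (n : ℕ) : ∑ i ∈ Finset.range n, (i : ℝ) = n * (n - 1) / 2 := by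
  induction n with
  | zero => simp
  | succ n ih => rw [Finset.sum_range_succ, ih]; push_cast; ring

lemma log_qprod_seqQ_le (S : Set ℕ) (n : ℕ) :
    Real.log (qprod (seqQ S) n) ≤ n * (n - 1) / 2 * Real.log 2 + n * Real.log (n + 3) := by
  rw [log_qprod (one_le_seqQ S), ← sum_range_cast, Finset.sum_mul]
  have hc : (n : ℝ) * Real.log (n + 3) = ∑ _i ∈ Finset.range n, Real.log ((n : ℝ) + 3) := by simp
  rw [hc, ← Finset.sum_add_distrib]
  refine Finset.sum_le_sum fun i hi => ?_
  have hi' : (i : ℝ) ≤ n := by exact_mod_cast (Finset.mem_range.mp hi).le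
  have h1 : (seqQ S i : ℝ) ≤ 2 ^ i * (n + 3) := by
    have : (seqQ S i : ℝ) ≤ 2 ^ i * (i + 3) := by exact_mod_cast seqQ_le S i
    exact this.trans (by gcongr)
  refine (Real.log_le_log (by exact_mod_cast one_le_seqQ S i) h1).trans (le_of_eq ?_)
  rw [Real.log_mul (by positivity) (by positivity), Real.log_pow]

lemma le_log_qprod_numDigits (S : Set ℕ) (n : ℕ) :
    (n * (n - 1) / 2 - n * pinCount S n) * Real.log 2 ≤ Real.log (qprod (numDigits S) n) := by
  rw [log_qprod (numDigits_pos S), ← sum_range_cast, pinCount, Finset.card_filter]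
  push_cast
  rw [Finset.mul_sum, ← Finset.sum_sub_distrib, Finset.sum_mul]
  refine Finset.sum_le_sum fun i hi => ?_
  have hi' : (i : ℝ) ≤ n := by exact_mod_cast (Finset.mem_range.mp hi).le
  have hl : 0 < Real.log 2 := Real.log_pos (by norm_num)
  unfold numDigits
  split_ifs
  · simp; nlinarith
  · simp

lemma eventually_qprod_rpow_le (S : Set ℕ) {r : ℝ} (hr : 0 < r) (hr1 : r < 1) :
    ∀ᶠ n : ℕ in atTop, qprod (seqQ S) (n + 2) ^ r ≤ qprod (numDigits S) n := by
  set L := Real.log 2 with hL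
  have hl : 0 < L := Real.log_pos (by norm_num)
  have hinv : Tendsto (fun n : ℕ => 1 / (n : ℝ)) atTop (𝓝 0) := tendsto_one_div_atTop_nhds_zero_nat
  have hlog : Tendsto (fun n : ℕ => Real.log n / (n : ℝ)) atTop (𝓝 0) :=
    (Real.isLittleO_log_id_atTop.tendsto_div_nhds_zero).comp tendsto_natCast_atTop_atTop
  have hlim : Tendsto (fun n : ℕ => (((1 : ℝ) - 1 / n) / 2 - pinCount S n / n) * L -
      r * (((1 + 2 * (1 / n)) * (1 + 1 / n)) / 2 * L +
        (1 + 2 * (1 / n)) * (Real.log 6 * (1 / n) + Real.log n / n))) atTop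
      (𝓝 (((1 - 0) / 2 - 0) * L - r * (((1 + 2 * 0) * (1 + 0)) / 2 * L +
        (1 + 2 * 0) * (Real.log 6 * 0 + 0)))) :=
    ((((hinv.const_sub 1).div_const 2).sub (tendsto_pinCount_div S)).mul_const L).sub
      ((((((hinv.const_mul 2).const_add 1).mul (hinv.const_add 1)).div_const 2).mul_const L).add
        (((hinv.const_mul 2).const_add 1).mul ((hinv.const_mul _).add hlog)) |>.const_mul r)
  have hpos : 0 < ((1 - 0) / 2 - 0) * L - r * (((1 + 2 * 0) * (1 + 0)) / 2 * L +
      (1 + 2 * 0) * (Real.log 6 * 0 + 0)) := by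
    have := mul_pos (sub_pos.mpr hr1) hl
    linarith
  filter_upwards [hlim.eventually_const_lt hpos, eventually_gt_atTop 0]
    with n hn hn0
  have hn' : (1 : ℝ) ≤ n := by exact_mod_cast hn0
  have hq := qprod_pos (one_le_seqQ S) (n + 2)
  have ha := qprod_pos (numDigits_pos S) n
  rw [← Real.log_le_log_iff (Real.rpow_pos_of_pos hq r) ha, Real.log_rpow hq]
  have h1 := log_qprod_seqQ_le S (n + 2)
  have h2 := le_log_qprod_numDigits S n
  have h3 : Real.log (((n + 2 : ℕ) : ℝ) + 3) ≤ Real.log 6 + Real.log n := by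
    rw [← Real.log_mul (by norm_num) (by positivity)]
    exact Real.log_le_log (by positivity) (by push_cast; linarith)
  have h4 : Real.log (qprod (seqQ S) (n + 2)) ≤ ((n : ℝ) + 2) * (n + 1) / 2 * L +
      (n + 2) * (Real.log 6 + Real.log n) := by
    refine h1.trans ?_
    push_cast at h3 ⊢
    have := mul_le_mul_of_nonneg_left h3 (by positivity : (0 : ℝ) ≤ n + 2)
    linarith
  refine (mul_le_mul_of_nonneg_left h4 hr.le).trans (le_trans ?_ h2)
  have hsq : (0 : ℝ) < n ^ 2 := by positivity
  have h5 := mul_pos hsq hn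
  have e : (n : ℝ) ^ 2 * ((((1 : ℝ) - 1 / n) / 2 - pinCount S n / n) * L -
      r * (((1 + 2 * (1 / n)) * (1 + 1 / n)) / 2 * L +
        (1 + 2 * (1 / n)) * (Real.log 6 * (1 / n) + Real.log n / n))) =
      (n * (n - 1) / 2 - n * pinCount S n) * L - r * (((n : ℝ) + 2) * (n + 1) / 2 * L +
      (n + 2) * (Real.log 6 + Real.log n)) := by
    field_simp
  linarith

lemma two_pow_le_qprod {q : ℕ → ℕ} (hq : IsBasic q) (n : ℕ) : (2 : ℝ) ^ n ≤ qprod q n := by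
  unfold qprod
  rw [← Finset.card_range n, ← Finset.prod_const, Finset.card_range]
  exact Finset.prod_le_prod (fun _ _ => by norm_num) fun i _ => by exact_mod_cast hq i

lemma le_dimH_cantorDigitSet_seqQ (S : Set ℕ) {r : NNReal} (hr : 0 < r) (hr1 : r < 1) :
    (r : ENNReal) ≤ dimH (cantorDigitSet (seqQ S) (lowDigit S) (numDigits S)) := by
  have hq := isBasic_seqQ S
  have hev := eventually_qprod_rpow_le S (r := r) (by exact_mod_cast hr) (by exact_mod_cast hr1)
  have hinf : Tendsto (qprod (numDigits S)) atTop atTop := by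
    refine tendsto_atTop_mono' atTop hev ?_
    refine (tendsto_rpow_atTop (by exact_mod_cast hr)).comp ?_
    exact (tendsto_add_atTop_iff_nat 2).mpr (tendsto_atTop_mono (two_pow_le_qprod hq)
      (tendsto_pow_atTop_atTop_of_one_lt one_lt_two))
  have hbdd : IsBoundedUnder (· ≤ ·) atTop
      fun n : ℕ => qprod (seqQ S) (n + 2) ^ (r : ℝ) / qprod (numDigits S) n :=
    isBoundedUnder_of_eventually_le (a := 1) (by
      filter_upwards [hev] with n hn
      exact (div_le_one (qprod_pos (numDigits_pos S) n)).mpr hn)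
  obtain ⟨C, hC⟩ := hbdd.bddAbove_range
  refine le_dimH_cantorDigitSet hq (numDigits_pos S) (lowDigit_add_le S) hinf hr
    (C := C.toNNReal) fun n => ?_
  rw [← div_le_iff₀ (qprod_pos (numDigits_pos S) n)]
  exact (hC ⟨n, rfl⟩).trans (Real.le_coe_toNNReal C)

end Dimension

/-- If `S` is almost closed under addition, then there exists a fully divergent, infinite
in limit basic sequence `Q` such that
`dim_H(DN(Q) ∩ DN_{Ab}(Q) ∩ RN^{I}(Q) ∩ RN^{II}(Q) ∩ N^{I}_{Ab}(Q) ∩ ⋂_{k∈S} N_k(Q)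
  \ (N^{II}(Q) ∪ ⋃_{k∉S} N_k(Q))) = 1`. -/
theorem stmt7 (S : Set ℕ) (hSpos : 0 ∉ S) (hS : AlmostClosed S) :
    ∃ Q : ℕ → ℕ, IsBasic Q ∧ FullyDivergent Q ∧ InfiniteInLimit Q ∧
      dimH (({x : ℝ | DistNormal Q x} ∩ {x : ℝ | APDistAbnormal Q x} ∩
        {x : ℝ | MemRNI Q x} ∩ {x : ℝ | MemRNII Q x} ∩ {x : ℝ | APAbnormalI Q x} ∩
        (⋂ k ∈ S, {x : ℝ | QNormalOfOrder Q k x})) \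
        ({x : ℝ | APNormalII Q x} ∪
          ⋃ k ∈ {k : ℕ | 1 ≤ k ∧ k ∉ S}, {x : ℝ | QNormalOfOrder Q k x})) = 1 := by
  refine ⟨seqQ S, isBasic_seqQ S, fullyDivergent_seqQ S, infiniteInLimit_seqQ S,
    le_antisymm ?_ ?_⟩
  · exact (dimH_mono (Set.subset_univ _)).trans Real.dimH_univ.le
  · refine le_trans ?_ (dimH_mono
      (s := cantorDigitSet (seqQ S) (lowDigit S) (numDigits S)) ?_)
    · refine le_of_forall_lt fun b hb => ?_
      obtain ⟨r, hbr, hr1⟩ := ENNReal.lt_iff_exists_nnreal_btwn.mp hb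
      exact hbr.trans_le (le_dimH_cantorDigitSet_seqQ S
        (ENNReal.coe_pos.mp (pos_of_gt hbr)) (by exact_mod_cast hr1))
    · rintro x ⟨E, hE : Admissible S E, rfl⟩
      have hx := qdigit_cantorTail (isBasic_seqQ S) hE.add_two_le
      simp only [Set.mem_sdiff, Set.mem_inter_iff, Set.mem_ofPred_eq, Set.mem_iInter, Set.mem_union,
        Set.mem_iUnion, not_or]
      refine ⟨⟨⟨⟨⟨⟨hE.distNormal, hE.apDistAbnormal⟩, hE.memRNI hx⟩, hE.memRNII hx⟩,
        hE.apAbnormalI hx⟩, fun k hk => ?_⟩, hE.not_apNormalII hx, ?_⟩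
      · exact (hE.qNormalOfOrder_iff hx
          (Nat.pos_of_ne_zero fun h => hSpos (h ▸ hk))).mpr hk
      · rintro ⟨k, ⟨hk, hkS⟩, h⟩
        exact hkS ((hE.qNormalOfOrder_iff hx hk).mp h)
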